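/- arXiv:2006.08909 — 10 statements merged into one kernel-verified Lean document; each statement's English description precedes it below -/
import Mathlib

section
/- For all n ≥ 0, s_{2n} = s_n if n is even and s_{2n} = s_n + 1 if n is odd; and s_{2n+1} = s_n + 1 if n is even and s_{2n+1} = s_n if n is odd. -/
/-- The sequence `j`: `j 0 = 0`, `j (2k) = j k`, `j (2k+1) = (-1)^k`. -/
def j : ℕ → ℤ
  | 0 => 0
  | (n+1) =>
      if (n+1) % 2 = 1 then (-1 : ℤ) ^ ((n+1)/2)
      else j ((n+1)/2)
decreasing_by omega

/-- `s n = 1 + ∑_{k=0}^{n} j k`. -/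
def s (n : ℕ) : ℤ := 1 + ∑ k ∈ Finset.range (n+1), j k

theorem j_two_mul (k : ℕ) : j (2 * k) = j k := by
  cases k with
  | zero => rfl
  | succ m =>
    rw [show 2 * (m + 1) = (2 * m + 1) + 1 by ring, j, if_neg (by omega),
      show (2 * m + 1 + 1) / 2 = m + 1 by omega]

theorem j_two_mul_add_one (k : ℕ) : j (2 * k + 1) = (-1) ^ k := by
  rw [j, if_pos (by omega), show (2 * k + 1) / 2 = k by omega]

theorem s_succ (n : ℕ) : s (n + 1) = s n + j (n + 1) := by
  rw [s, s, Finset.sum_range_succ, add_assoc]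

theorem s_two_mul_add_one (n : ℕ) : s (2 * n + 1) = s (2 * n) + (-1) ^ n := by
  rw [s_succ, j_two_mul_add_one]

theorem two_mul_s_two_mul (n : ℕ) : 2 * s (2 * n) = 2 * s n + 1 - (-1) ^ n := by
  induction n with
  | zero => simp
  | succ n ih =>
    have hs : s (2 * (n + 1)) = s (2 * n + 1) + j (n + 1) := by
      rw [← j_two_mul (n + 1)]
      exact s_succ (2 * n + 1)
    rw [hs, s_two_mul_add_one, s_succ, pow_succ]
    linarith

theorem stmt0 (n : ℕ) :
    (Even n → s (2*n) = s n) ∧ (Odd n → s (2*n) = s n + 1) ∧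
    (Even n → s (2*n+1) = s n + 1) ∧ (Odd n → s (2*n+1) = s n) := by
  have h := two_mul_s_two_mul n
  have h' := s_two_mul_add_one n
  refine ⟨fun hn => ?_, fun hn => ?_, fun hn => ?_, fun hn => ?_⟩ <;>
    rw [hn.neg_one_pow] at h h' <;> linarith
end

section
/- For every n ≥ 0, s_n equals 1 plus the number of runs (maximal blocks of equal consecutive digits) in the binary expansion of n (the binary expansion of 0 is empty and has 0 runs). Equivalently, ∑_{k=0}^{n} j_k equals the number of runs in the binary expansion of n. -/
/-- The number of runs (maximal blocks of equal consecutive digits) in the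
binary expansion of `n`; the expansion of `0` is empty and has `0` runs. -/
def runCount (n : ℕ) : ℕ := ((Nat.digits 2 n).destutter (· ≠ ·)).length

theorem j_two_mul_add_two (k : ℕ) : j (2 * k + 2) = j (k + 1) := by
  rw [j, if_neg (by omega)]
  congr 1
  omega

/-- Prepending `a` to a list with head `b` creates a new run exactly when `a ≠ b`. -/
theorem length_destutter_ne_cons_cons {α : Type*} [DecidableEq α] (a b : α) (l : List α) :
    ((a :: b :: l).destutter (· ≠ ·)).length =
      ((b :: l).destutter (· ≠ ·)).length + if a = b then 0 else 1 := by
  by_cases h : a = b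
  · subst h
    simp [List.destutter_cons']
  · simp [List.destutter_cons', h]

/-- Appending a last binary digit to `n` creates a new run exactly when it differs from the last
digit of `n`. -/
theorem runCount_bit {n d : ℕ} (hd : d < 2) (h : n ≠ 0 ∨ d ≠ 0) :
    runCount (2 * n + d) = runCount n + if d = n % 2 then 0 else 1 := by
  have hdigits : Nat.digits 2 (2 * n + d) = d :: Nat.digits 2 n := by
    rw [add_comm]
    exact Nat.digits_add 2 one_lt_two d n hd h.symm
  rw [runCount, runCount, hdigits]
  rcases Nat.eq_zero_or_pos n with rfl | hn
  · have hd1 : d = 1 := by omega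
    simp [hd1]
  · rw [Nat.digits_def' one_lt_two hn, length_destutter_ne_cons_cons]

theorem runCount_two_mul (n : ℕ) : runCount (2 * n) = runCount n + n % 2 := by
  rcases Nat.eq_zero_or_pos n with rfl | hn
  · rfl
  · have h := runCount_bit (n := n) (d := 0) two_pos (.inl hn.ne')
    rw [add_zero] at h
    rw [h]
    split_ifs <;> omega

theorem runCount_two_mul_add_one (n : ℕ) :
    runCount (2 * n + 1) = runCount n + (n + 1) % 2 := by
  rw [runCount_bit one_lt_two (.inr one_ne_zero)]
  split_ifs <;> omega

theorem runCount_succ (n : ℕ) : (runCount (n + 1) : ℤ) = runCount n + j (n + 1) := by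
  induction n using Nat.strong_induction_on with
  | _ n ih =>
    obtain ⟨k, rfl | rfl⟩ := Nat.even_or_odd' n
    · rw [j_two_mul_add_one, runCount_two_mul, runCount_two_mul_add_one]
      rcases Nat.even_or_odd k with hk | hk
      · have := Nat.even_iff.mp hk
        rw [hk.neg_one_pow]
        omega
      · have := Nat.odd_iff.mp hk
        rw [hk.neg_one_pow]
        omega
    · have hk := ih k (by omega)
      rw [j_two_mul_add_two, show 2 * k + 1 + 1 = 2 * (k + 1) by ring, runCount_two_mul,
        runCount_two_mul_add_one]
      omega

theorem sum_j_eq_runCount (n : ℕ) : ∑ k ∈ Finset.range (n + 1), j k = (runCount n : ℤ) := by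
  induction n with
  | zero => simp [j, runCount]
  | succ n ih => rw [Finset.sum_range_succ, ih, runCount_succ]

theorem stmt1 (n : ℕ) :
    s n = 1 + (runCount n : ℤ) ∧
    ∑ k ∈ Finset.range (n+1), j k = (runCount n : ℤ) := by
  exact ⟨by rw [s, sum_j_eq_runCount], sum_j_eq_runCount n⟩
end

section
/- Define a_0 = 0 and let (a_n)_{n≥1} be the increasing enumeration of the positive integers whose odd part is congruent to 1 modulo 4. Then for all n ≥ 0, a_n + s_{a_n} = 2n + 1. -/
/-- The odd part (largest odd divisor) of a positive integer. -/
def oddPart (m : ℕ) : ℕ := m / 2 ^ (m.factorization 2)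

theorem oddPart_two_mul (k : ℕ) : oddPart (2 * k) = oddPart k := by
  have h := Nat.ordCompl_mul 2 k 2
  have h2 : 2 / 2 ^ (Nat.factorization 2 2) = 1 := by
    simp [Nat.prime_two.factorization_self]
  rw [h2, one_mul] at h
  exact h

theorem oddPart_two_mul_add_one (k : ℕ) : oddPart (2 * k + 1) = 2 * k + 1 := by
  rw [oddPart, Nat.factorization_eq_zero_of_not_dvd (by omega)]
  simp

theorem j_eq_ite_oddPart (m : ℕ) (hm : 0 < m) :
    j m = if oddPart m % 4 = 1 then 1 else -1 := by
  induction m using Nat.strong_induction_on with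
  | _ m ih =>
    obtain ⟨k, rfl | rfl⟩ := Nat.even_or_odd' m
    · rw [j_two_mul, oddPart_two_mul]
      exact ih k (by omega) (by omega)
    · rw [j_two_mul_add_one, oddPart_two_mul_add_one]
      obtain ⟨l, rfl | rfl⟩ := Nat.even_or_odd' k
      · rw [if_pos (by omega)]
        simp
      · rw [if_neg (by omega)]
        simp [pow_succ]

theorem add_s_eq_card (m : ℕ) :
    (m : ℤ) + s m = 2 * ((Finset.Icc 1 m).filter (fun k => oddPart k % 4 = 1)).card + 1 := by
  induction m with
  | zero => simp [s, j]
  | succ m ih =>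
    have hs : s (m + 1) = s m + j (m + 1) := by
      rw [s, s, Finset.sum_range_succ _ (m + 1), add_assoc]
    rw [hs, j_eq_ite_oddPart (m + 1) m.succ_pos,
      ← Finset.insert_Icc_right_eq_Icc_add_one (by omega), Finset.filter_insert]
    split_ifs
    · rw [Finset.card_insert_of_notMem (by simp)]
      push_cast
      linarith
    · push_cast
      linarith

theorem stmt3 (a : ℕ → ℕ) (ha : StrictMono a) (ha0 : a 0 = 0)
    (hrange : ∀ m : ℕ, 0 < m →
      ((∃ n, a n = m) ↔ oddPart m % 4 = 1)) :
    ∀ n : ℕ, (a n : ℤ) + s (a n) = 2 * n + 1 := by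
  intro n
  have himage : (Finset.Icc 1 (a n)).filter (fun k => oddPart k % 4 = 1)
      = (Finset.Icc 1 n).image a := by
    ext m
    simp only [Finset.mem_filter, Finset.mem_Icc, Finset.mem_image]
    constructor
    · rintro ⟨⟨hpos, hle⟩, hm⟩
      obtain ⟨i, rfl⟩ := (hrange m hpos).2 hm
      refine ⟨i, ⟨Nat.pos_of_ne_zero ?_, ha.le_iff_le.1 hle⟩, rfl⟩
      rintro rfl
      omega
    · rintro ⟨i, ⟨hpos, hle⟩, rfl⟩
      have hai : 0 < a i := ha0 ▸ ha hpos
      exact ⟨⟨hai, ha.monotone hle⟩, (hrange _ hai).1 ⟨i, rfl⟩⟩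
  rw [add_s_eq_card, himage, Finset.card_image_of_injective _ ha.injective, Nat.card_Icc,
    Nat.add_sub_cancel]
end

section
/- Define ψ(r) = 8r + (1 + s_{16r+2})/2 for r ≥ 0. Then ψ is strictly increasing, and moreover for all r ≠ r' one has |ψ(r) - ψ(r')| ≥ 7; in fact ψ(r+1) - ψ(r) ≥ 7 for all r ≥ 0. -/
/-- `ψ r = 8r + (1 + s (16r+2))/2`. -/
def psi (r : ℕ) : ℤ := 8 * r + (1 + s (16 * r + 2)) / 2

theorem neg_one_le_j (n : ℕ) : -1 ≤ j n := by
  induction n using Nat.strong_induction_on with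
  | _ n ih =>
    rcases Nat.even_or_odd' n with ⟨k, rfl | rfl⟩
    · rw [j_two_mul]
      rcases Nat.eq_zero_or_pos k with rfl | hk
      · simp [j]
      · exact ih k (by omega)
    · rw [j_two_mul_add_one]
      rcases neg_one_pow_eq_or ℤ k with h | h <;> simp [h]

theorem j_four_mul_add_one (k : ℕ) : j (4 * k + 1) = 1 := by
  rw [show 4 * k + 1 = 2 * (2 * k) + 1 by ring, j_two_mul_add_one, pow_mul]
  simp

theorem j_four_mul_add_three (k : ℕ) : j (4 * k + 3) = -1 := by
  rw [show 4 * k + 3 = 2 * (2 * k + 1) + 1 by ring, j_two_mul_add_one, pow_succ, pow_mul]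
  simp

/-- Over four consecutive indices the two odd-indexed terms of `j` cancel. -/
theorem s_four_mul_add_six (k : ℕ) :
    s (4 * k + 6) = s (4 * k + 2) + j (k + 1) + j (2 * k + 3) := by
  have h3 := s_succ (4 * k + 2)
  have h4 := s_succ (4 * k + 3)
  have h5 := s_succ (4 * k + 4)
  have h6 := s_succ (4 * k + 5)
  have e3 := j_four_mul_add_three k
  have e4 : j (4 * k + 4) = j (k + 1) := by
    rw [show 4 * k + 4 = 2 * (2 * (k + 1)) by ring, j_two_mul, j_two_mul]
  have e5 := j_four_mul_add_one (k + 1)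
  have e6 : j (4 * k + 6) = j (2 * k + 3) := by
    rw [show 4 * k + 6 = 2 * (2 * k + 3) by ring, j_two_mul]
  rw [mul_add] at e5
  simp only [add_assoc, Nat.reduceAdd, Nat.reduceMul] at *
  linarith

theorem s_sixteen_mul_add_eighteen (r : ℕ) :
    s (16 * r + 18) = s (16 * r + 2) + j (2 * r + 1) + j (r + 1) := by
  have h0 := s_four_mul_add_six (4 * r)
  have h1 := s_four_mul_add_six (4 * r + 1)
  have h2 := s_four_mul_add_six (4 * r + 2)
  have h3 := s_four_mul_add_six (4 * r + 3)
  have a1 := j_four_mul_add_one r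
  have a2 : j (4 * r + 2) = j (2 * r + 1) := by
    rw [show 4 * r + 2 = 2 * (2 * r + 1) by ring, j_two_mul]
  have a3 := j_four_mul_add_three r
  have a4 : j (4 * r + 4) = j (r + 1) := by
    rw [show 4 * r + 4 = 2 * (2 * (r + 1)) by ring, j_two_mul, j_two_mul]
  have b3 := j_four_mul_add_three (2 * r)
  have b5 := j_four_mul_add_one (2 * r + 1)
  have b7 := j_four_mul_add_three (2 * r + 1)
  have b9 := j_four_mul_add_one (2 * r + 2)
  ring_nf at *
  linarith

theorem psi_add_seven_le (r : ℕ) : psi r + 7 ≤ psi (r + 1) := by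
  have h := s_sixteen_mul_add_eighteen r
  have h1 := neg_one_le_j (2 * r + 1)
  have h2 := neg_one_le_j (r + 1)
  rw [psi, psi, show 16 * (r + 1) + 2 = 16 * r + 18 by ring, h]
  push_cast
  omega

theorem stmt6 :
    StrictMono psi ∧
    (∀ r r' : ℕ, r ≠ r' → |psi r - psi r'| ≥ 7) ∧
    (∀ r : ℕ, psi (r + 1) - psi r ≥ 7) := by
  have hmono : StrictMono psi :=
    strictMono_nat_of_lt_succ fun r => by linarith [psi_add_seven_le r]
  have hgap : ∀ a b : ℕ, a < b → psi a + 7 ≤ psi b := fun a b hab =>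
    (psi_add_seven_le a).trans (hmono.monotone hab)
  refine ⟨hmono, fun r r' hne => ?_, fun r => by linarith [psi_add_seven_le r]⟩
  rcases hne.lt_or_gt with h | h
  · exact le_abs.mpr (Or.inr (by linarith [hgap r r' h]))
  · exact le_abs.mpr (Or.inl (by linarith [hgap r' r h]))
end

section
/- Let h_n be the n-th Hankel determinant of the coefficient sequence of B(x) = 1 - x·r(x), and g_n the n-th Hankel determinant of the sequence (-r_1, -r_2, -r_3, ...). Then h_0 = h_1 = 1, h_2 = -2, and for every n ≥ 3, if k ≥ 0 is the unique integer with 2^k < n ≤ 2^{k+1} and m = 2^{k+1} - n + 1, then h_n = (-1)^n · (h_m + g_{m-1}). -/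
/-- The `n`-th Hankel determinant of the sequence `a`: the determinant of the
`n × n` matrix whose `(i,j)` entry is `a (i + j)` (with `H_0 = 1`). -/
def hankel (a : ℕ → ℤ) (n : ℕ) : ℤ :=
  Matrix.det (Matrix.of fun i j : Fin n => a (i.1 + j.1))

open scoped Classical in
/-- The Rueppel sequence: `r n = 1` if `n = 2^m - 1` for some `m`, else `0`. -/
noncomputable def ruep (n : ℕ) : ℤ := if ∃ m : ℕ, n = 2 ^ m - 1 then 1 else 0

/-- Hankel determinants of the shifted negated Rueppel sequence `(-r_{n+1})`. -/
noncomputable def g (n : ℕ) : ℤ := hankel (fun i => -ruep (i + 1)) n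

/-- Coefficient sequence of `B(x) = 1 - x·r(x)`. -/
noncomputable def bseq : ℕ → ℤ
  | 0 => 1
  | (n+1) => -ruep n

/-- Hankel determinants of the coefficient sequence of `1 - x·r(x)`. -/
noncomputable def h (n : ℕ) : ℤ := hankel bseq n

theorem bseq_two_pow (a : ℕ) : bseq (2 ^ a) = -1 := by
  obtain ⟨t, ht⟩ : ∃ t, 2 ^ a = t + 1 := Nat.exists_eq_add_one.mpr (by positivity)
  have hr : ruep t = 1 := if_pos ⟨a, by omega⟩
  rw [ht, bseq, hr]

theorem exists_eq_two_pow_of_bseq_ne_zero {t : ℕ} (h0 : t ≠ 0) (ht : bseq t ≠ 0) :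
    ∃ a, t = 2 ^ a := by
  obtain ⟨t, rfl⟩ := Nat.exists_eq_add_one_of_ne_zero h0
  by_contra hc
  refine ht ?_
  have hr : ruep t = 0 := by
    refine if_neg ?_
    rintro ⟨a, ha⟩
    have : 0 < 2 ^ a := by positivity
    exact hc ⟨a, by omega⟩
  rw [bseq, hr, neg_zero]

/-- The sequence `bseq` vanishes strictly between consecutive powers of two. -/
theorem bseq_eq_zero_of_lt_of_lt {k t : ℕ} (h1 : 2 ^ k < t) (h2 : t < 2 ^ (k + 1)) :
    bseq t = 0 := by
  by_contra hc
  obtain ⟨a, rfl⟩ := exists_eq_two_pow_of_bseq_ne_zero (by omega) hc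
  have := (Nat.pow_lt_pow_iff_right (by norm_num)).mp h1
  have := (Nat.pow_lt_pow_iff_right (by norm_num)).mp h2
  omega

theorem hankel_succ_of_eq_zero (a : ℕ → ℤ) (s : ℕ) (ha : ∀ t, s < t → t ≤ 2 * s → a t = 0) :
    hankel a (s + 1) = (-1) ^ s * a s * hankel (fun t => a (t + 1)) s := by
  unfold hankel
  rw [Matrix.det_succ_row _ (Fin.last s), Finset.sum_eq_single 0]
  · simp only [Matrix.of_apply, Fin.val_last, Fin.val_zero, add_zero]
    congr 2
    ext i j
    simp [add_assoc]
  · intro j _ hj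
    have : (j : ℕ) ≠ 0 := fun hc => hj (Fin.ext hc)
    have hlast : a ((Fin.last s).1 + j.1) = 0 :=
      ha _ (by rw [Fin.val_last]; omega) (by rw [Fin.val_last]; omega)
    rw [Matrix.of_apply, hlast]
    ring
  · simp

/-- The Hankel determinant of a matrix vanishing below its antidiagonal. -/
theorem hankel_of_eq_zero (s : ℕ) (a : ℕ → ℤ) (c : ℤ) (hc : 0 < s → a (s - 1) = c)
    (ha : ∀ t, s ≤ t → t + 2 ≤ 2 * s → a t = 0) :
    hankel a s = (-1) ^ s.choose 2 * c ^ s := by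
  induction s generalizing a with
  | zero => simp [hankel]
  | succ s ih =>
    rw [hankel_succ_of_eq_zero a s fun t h1 h2 => ha t h1 (by omega),
      ih (fun t => a (t + 1)) (fun h0 => ?_) fun t h1 h2 => ha _ (by omega) (by omega),
      Nat.choose_succ_succ' s 1, Nat.choose_one_right]
    · have := hc (by omega)
      rw [Nat.add_sub_cancel] at this
      rw [this]
      ring
    · rw [← hc (by omega)]
      congr 1
      omega

/-- Adding `1` to the corner entry of a Hankel matrix adds the determinant of the complementary
minor. -/
theorem det_hankel_add_single (a : ℕ → ℤ) (p : ℕ) :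
    (Matrix.of (fun i j : Fin (p + 1) => a (i.1 + j.1)) + Matrix.single 0 0 1).det =
      hankel a (p + 1) + hankel (fun t => a (t + 2)) p := by
  set A : Matrix (Fin (p + 1)) (Fin (p + 1)) ℤ := Matrix.of fun i j => a (i.1 + j.1) with hA
  have hrow : A + Matrix.single 0 0 1 = A.updateRow 0 (A 0 + Pi.single 0 1) := by
    ext i j
    refine Fin.cases ?_ (fun i => ?_) i
    · refine Fin.cases ?_ (fun j => ?_) j <;>
        simp [Matrix.single, eq_comm (a := (0 : Fin (p + 1)))]
    · simp [Matrix.single, eq_comm (a := (0 : Fin (p + 1)))]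
  rw [hrow, Matrix.det_updateRow_add, Matrix.updateRow_eq_self, ← Matrix.adjugate_apply,
    Matrix.adjugate_fin_succ_eq_det_submatrix]
  have hminor : A.submatrix (Fin.succAbove 0) (Fin.succAbove 0) =
      Matrix.of fun i j : Fin p => a (i.1 + j.1 + 2) := by
    ext i j
    simp only [hA, Matrix.submatrix_apply, Matrix.of_apply, Fin.zero_succAbove, Fin.val_succ]
    congr 1
    omega
  rw [hminor]
  simp [hankel, hA]

theorem bseq_mul_bseq {k p i U j : ℕ} (hi : i ≤ p) (hU : p < U) (hUp : U + p < 2 ^ (k + 1))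
    (hj : j + p ≤ 2 ^ (k + 1)) :
    bseq (2 ^ (k + 1) - U + i) * bseq (U + j) =
      (if U = 2 ^ k then (if i = 0 ∧ j = 0 then 1 else 0) else 0) -
        if U + j = 2 ^ (k + 1) then bseq (i + j) else 0 := by
  have hk : 2 ^ (k + 1) = 2 * 2 ^ k := by ring
  by_cases hUj : U + j = 2 ^ (k + 1)
  · have hij : ¬ (i = 0 ∧ j = 0) := by omega
    have : 2 ^ (k + 1) - U + i = i + j := by omega
    simp [hUj, hij, this, bseq_two_pow]
  rw [if_neg hUj]
  by_cases hUk : U = 2 ^ k ∧ i = 0 ∧ j = 0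
  · obtain ⟨rfl, rfl, rfl⟩ := hUk
    have : 2 ^ (k + 1) - 2 ^ k + 0 = 2 ^ k := by omega
    rw [this]
    simp [bseq_two_pow]
  have hzero : bseq (2 ^ (k + 1) - U + i) * bseq (U + j) = 0 := by
    by_cases hlt : U < 2 ^ k + i
    · rw [bseq_eq_zero_of_lt_of_lt (k := k) (by omega) (by omega), zero_mul]
    by_cases hlt' : U + j < 2 ^ (k + 1)
    · rw [bseq_eq_zero_of_lt_of_lt (k := k) (by omega) hlt', mul_zero]
    · have hk' : 2 ^ (k + 1 + 1) = 2 * 2 ^ (k + 1) := by ring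
      rw [bseq_eq_zero_of_lt_of_lt (k := k + 1) (t := U + j) (by omega) (by omega), mul_zero]
  rw [hzero]
  split_ifs <;> first | rfl | omega

theorem sum_bseq_mul_bseq {k p s i j : ℕ} (hs : 2 * p + 1 + s = 2 ^ (k + 1))
    (hi : i ≤ p) (hj : j < p + 1 + s) :
    ∑ u : Fin s, -bseq (2 ^ (k + 1) - (p + 1 + u) + i) * bseq (p + 1 + u + j) =
      (if p < j then bseq (i + j) else 0) - if i = 0 ∧ j = 0 then 1 else 0 := by
  have hk : 2 ^ (k + 1) = 2 * 2 ^ k := by ring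
  have hterm (u : Fin s) :
      -bseq (2 ^ (k + 1) - (p + 1 + u) + i) * bseq (p + 1 + u + j) =
        (if p + 1 + u + j = 2 ^ (k + 1) then bseq (i + j) else 0) -
          if p + 1 + u.1 = 2 ^ k then (if i = 0 ∧ j = 0 then 1 else 0) else 0 := by
    rw [neg_mul, bseq_mul_bseq hi (by omega) (by omega) (by omega), neg_sub]
  rw [Finset.sum_congr rfl fun u _ => hterm u, Finset.sum_sub_distrib]
  congr 1
  · split_ifs with hpj
    · rw [Finset.sum_eq_single ⟨2 ^ (k + 1) - (p + 1) - j, by omega⟩, if_pos (by simp; omega)]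
      · intro u _ hu
        exact if_neg fun hc => hu (Fin.ext (by simp; omega))
      · simp
    · exact Finset.sum_eq_zero fun u _ => if_neg (by omega)
  · rw [Finset.sum_eq_single ⟨2 ^ k - (p + 1), by omega⟩, if_pos (by simp; omega)]
    · intro u _ hu
      exact if_neg fun hc => hu (Fin.ext (by simp; omega))
    · simp

theorem hankel_bseq_eq_mul {k p s : ℕ} (hs : 2 * p + 1 + s = 2 ^ (k + 1)) :
    hankel bseq (p + 1 + s) =
      (hankel bseq (p + 1) + hankel (fun t => bseq (t + 2)) p) *
        hankel (fun t => bseq (2 * (p + 1) + t)) s := by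
  let A : Matrix (Fin (p + 1)) (Fin (p + 1)) ℤ := Matrix.of fun i j => bseq (i.1 + j.1)
  let B : Matrix (Fin (p + 1)) (Fin s) ℤ := Matrix.of fun i j => bseq (i.1 + (p + 1 + j.1))
  let C : Matrix (Fin s) (Fin (p + 1)) ℤ := Matrix.of fun i j => bseq (p + 1 + i.1 + j.1)
  let D : Matrix (Fin s) (Fin s) ℤ := Matrix.of fun i j => bseq (2 * (p + 1) + (i.1 + j.1))
  let X : Matrix (Fin (p + 1)) (Fin s) ℤ :=
    Matrix.of fun i u => -bseq (2 ^ (k + 1) - (p + 1 + u.1) + i.1)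
  have hblocks : (Matrix.of fun i j : Fin (p + 1 + s) => bseq (i.1 + j.1)).submatrix
      finSumFinEquiv finSumFinEquiv = Matrix.fromBlocks A B C D := by
    ext (i | i) (j | j)
    · simp [A]
    · simp [B]
    · simp [C]
    · simp only [D, Matrix.submatrix_apply, Matrix.of_apply, Matrix.fromBlocks_apply₂₂,
        finSumFinEquiv_apply_right, Fin.val_natAdd]
      congr 1
      omega
  have hA : A + Matrix.single 0 0 1 + X * C = A := by
    ext i j
    simp only [Matrix.add_apply, Matrix.mul_apply, X, C, Matrix.of_apply]
    rw [sum_bseq_mul_bseq hs (by omega) (by omega), if_neg (by omega)]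
    simp only [Matrix.single, Matrix.of_apply, eq_comm (a := (0 : Fin (p + 1))), Fin.ext_iff,
      Fin.val_zero]
    ring
  have hB : X * D = B := by
    ext i j
    simp only [Matrix.mul_apply, X, D, B, Matrix.of_apply]
    have := sum_bseq_mul_bseq (j := p + 1 + j) hs (show i.1 ≤ p by omega) (by omega)
    rw [if_pos (by omega), if_neg (by omega), sub_zero] at this
    rw [← this]
    refine Finset.sum_congr rfl fun u _ => ?_
    congr 2
    omega
  have hfactor : Matrix.fromBlocks A B C D =
      Matrix.fromBlocks 1 X 0 1 * Matrix.fromBlocks (A + Matrix.single 0 0 1) 0 C D := by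
    rw [Matrix.fromBlocks_multiply]
    simp [hA, hB]
  rw [← det_hankel_add_single, hankel, ← Matrix.det_submatrix_equiv_self finSumFinEquiv, hblocks,
    hfactor, Matrix.det_mul, Matrix.det_fromBlocks_zero₂₁, Matrix.det_fromBlocks_zero₁₂]
  simp [hankel, A, D]

theorem stmt9 :
    h 0 = 1 ∧ h 1 = 1 ∧ h 2 = -2 ∧
    ∀ n k : ℕ, 3 ≤ n → 2 ^ k < n → n ≤ 2 ^ (k + 1) →
      h n = (-1 : ℤ) ^ n *
        (h (2 ^ (k + 1) - n + 1) + g (2 ^ (k + 1) - n + 1 - 1)) := by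
  have hb0 : bseq 0 = 1 := rfl
  have hb1 : bseq 1 = -1 := bseq_two_pow 0
  have hb2 : bseq 2 = -1 := bseq_two_pow 1
  refine ⟨by simp [h, hankel], by simp [h, hankel, hb0],
    by simp [h, hankel, Matrix.det_fin_two, hb0, hb1, hb2], ?_⟩
  intro n k hn hkn hnk
  have hk : 2 ^ (k + 1) = 2 * 2 ^ k := by ring
  obtain ⟨q, hq⟩ : ∃ q, 2 ^ k = 2 * q := by
    cases k with
    | zero => norm_num at hnk; omega
    | succ k => exact ⟨2 ^ k, by ring⟩
  obtain ⟨e, rfl⟩ : ∃ e, n = 2 ^ k + 1 + e := ⟨n - (2 ^ k + 1), by omega⟩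
  obtain ⟨p, hp⟩ : ∃ p, 2 ^ (k + 1) - (2 ^ k + 1 + e) = p := ⟨_, rfl⟩
  have hsize : 2 ^ k + 1 + e = p + 1 + (2 * e + 1) := by omega
  have hg : g p = hankel (fun t => bseq (t + 2)) p := rfl
  have hD : hankel (fun t => bseq (2 * (p + 1) + t)) (2 * e + 1) = (-1) ^ (2 ^ k + 1 + e) := by
    rw [hankel_of_eq_zero (2 * e + 1) _ (-1)]
    · have hchoose : (2 * e + 1).choose 2 = e * (2 * e + 1) := by
        rw [Nat.choose_two_right, Nat.add_sub_cancel]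
        exact Nat.div_eq_of_eq_mul_left (by norm_num) (by ring)
      rw [hchoose, ← pow_add, hq]
      refine neg_one_pow_congr ?_
      simp [parity_simps]
    · intro _
      rw [show 2 * (p + 1) + (2 * e + 1 - 1) = 2 ^ (k + 1) by omega, bseq_two_pow]
    · intro t h1 h2
      have hk' : 2 ^ (k + 1 + 1) = 2 * 2 ^ (k + 1) := by ring
      exact bseq_eq_zero_of_lt_of_lt (k := k + 1) (by omega) (by omega)
  rw [hp, Nat.add_sub_cancel, hg, ← hD, h, h, hsize,
    hankel_bseq_eq_mul (k := k) (by omega), mul_comm]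
end

section
/- Let h_n be the n-th Hankel determinant of the coefficient sequence of B(x) = 1 - x·r(x), and g_n the n-th Hankel determinant of the sequence (-r_1, -r_2, -r_3, ...). Then for every n ≥ 1, h_n ≠ 0 and sign(h_n) = g_{n-1}. -/
/-- `sign y = 1` if `y ≥ 0`, and `-1` if `y < 0`. -/
def isign (y : ℤ) : ℤ := if 0 ≤ y then 1 else -1

open scoped Classical in
/-- The indicator function of the powers of two. -/
noncomputable def powTwoInd (n : ℕ) : ℤ := if ∃ m : ℕ, n = 2 ^ m then 1 else 0

theorem powTwoInd_two_pow (t : ℕ) : powTwoInd (2 ^ t) = 1 := if_pos ⟨t, rfl⟩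

theorem powTwoInd_eq_zero {t n : ℕ} (h₁ : 2 ^ t < n) (h₂ : n < 2 ^ (t + 1)) :
    powTwoInd n = 0 := by
  refine if_neg ?_
  rintro ⟨s, rfl⟩
  have h₃ := (Nat.pow_lt_pow_iff_right (by norm_num : 1 < 2)).1 h₁
  have h₄ := (Nat.pow_lt_pow_iff_right (by norm_num : 1 < 2)).1 h₂
  omega

theorem powTwoInd_zero : powTwoInd 0 = 0 := by
  refine if_neg ?_
  rintro ⟨s, hs⟩
  have := Nat.two_pow_pos s
  omega

theorem ruep_eq_powTwoInd (n : ℕ) : ruep n = powTwoInd (n + 1) := by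
  unfold ruep powTwoInd
  congr 1
  refine propext (exists_congr fun s => ?_)
  have := Nat.two_pow_pos s
  omega

/-- The entry `(i, j)` of the Hankel matrix of `1 - x·r(x)`, with corner entry replaced by `c`. -/
noncomputable def cornerEntry (c : ℤ) (i j : ℕ) : ℤ :=
  (if i = 0 ∧ j = 0 then c else 0) - powTwoInd (i + j)

/-- The Hankel matrix of `1 - x·r(x)`, with corner entry replaced by `c`. -/
noncomputable def cornerMatrix (c : ℤ) (n : ℕ) : Matrix (Fin n) (Fin n) ℤ :=
  Matrix.of fun i j => cornerEntry c i j

theorem h_eq_det_cornerMatrix (n : ℕ) : h n = (cornerMatrix 1 n).det := by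
  unfold h hankel
  congr 1
  ext i j
  simp only [cornerMatrix, cornerEntry, Matrix.of_apply]
  rcases hs : i.1 + j.1 with _ | s
  · rw [if_pos (by omega), powTwoInd_zero]
    rfl
  · rw [if_neg (by omega), zero_sub, ← ruep_eq_powTwoInd]
    rfl

theorem det_cornerMatrix_one_sub_zero (n : ℕ) :
    (cornerMatrix 1 (n + 1)).det - (cornerMatrix 0 (n + 1)).det = g n := by
  rw [Matrix.det_succ_row_zero, Matrix.det_succ_row_zero, ← Finset.sum_sub_distrib,
    Finset.sum_eq_single 0]
  · have hminor (c : ℤ) :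
        ((cornerMatrix c (n + 1)).submatrix Fin.succ (Fin.succAbove 0)).det = g n := by
      unfold g hankel
      congr 1
      ext i j
      simp only [cornerMatrix, cornerEntry, Matrix.submatrix_apply, Matrix.of_apply,
        Fin.succAbove_zero, Fin.val_succ, ruep_eq_powTwoInd]
      rw [if_neg (by omega), zero_sub]
      congr 2
      omega
    rw [hminor, hminor]
    simp [cornerMatrix, cornerEntry, powTwoInd_zero]
  · intro j _ hj
    have hsub : (cornerMatrix 1 (n + 1)).submatrix Fin.succ j.succAbove =
        (cornerMatrix 0 (n + 1)).submatrix Fin.succ j.succAbove := by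
      ext i l
      simp [cornerMatrix, cornerEntry]
    rw [hsub]
    simp [cornerMatrix, cornerEntry, hj]
  · simp

/-- The lower right block of a corner matrix, with rows and columns `a, …, a + q - 1`. -/
noncomputable def tailBlock (a q : ℕ) : Matrix (Fin q) (Fin q) ℤ :=
  Matrix.of fun i j => -powTwoInd (a + i + (a + j))

theorem det_tailBlock {t a q : ℕ} (ha : 0 < a) (haq : 2 * a + q = 2 ^ (t + 1) + 1) :
    (tailBlock a q).det = 1 ∨ (tailBlock a q).det = -1 := by
  have htri : ((tailBlock a q).submatrix id (Fin.revPerm : Equiv.Perm (Fin q))).det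
      = (-1) ^ q := by
    rw [Matrix.det_of_isUpperTriangular]
    · have hdiag (i : Fin q) :
          (tailBlock a q).submatrix id (Fin.revPerm : Equiv.Perm (Fin q)) i i = -1 := by
        simp only [tailBlock, Matrix.submatrix_apply, Matrix.of_apply, id, Fin.revPerm_apply,
          Fin.val_rev]
        rw [show a + i.1 + (a + (q - (i.1 + 1))) = 2 ^ (t + 1) by omega, powTwoInd_two_pow]
      rw [Finset.prod_congr rfl fun i _ => hdiag i]
      simp
    · intro i j hij
      have hij' : j.1 < i.1 := hij
      simp only [tailBlock, Matrix.submatrix_apply, Matrix.of_apply, id, Fin.revPerm_apply,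
        Fin.val_rev]
      rw [powTwoInd_eq_zero (t := t + 1) (by omega) (by rw [pow_succ 2 (t + 1)]; omega), neg_zero]
  rw [Matrix.det_permute'] at htri
  have hunit : IsUnit (tailBlock a q).det := by
    refine isUnit_of_mul_isUnit_right (x := ((Equiv.Perm.sign
      (Fin.revPerm : Equiv.Perm (Fin q)) : ℤˣ) : ℤ)) ?_
    have := (isUnit_one (M := ℤ)).neg.pow q
    rw [← htri] at this
    exact this
  exact Int.isUnit_iff.1 hunit

theorem det_cornerMatrix_add {t a q : ℕ} (ha : 0 < a) (hat : a ≤ 2 ^ t)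
    (haq : 2 * a + q = 2 ^ (t + 1) + 1) (c : ℤ) :
    (cornerMatrix c (a + q)).det = (tailBlock a q).det * (cornerMatrix (c + 1) a).det := by
  have hpow : 2 ^ (t + 1) = 2 * 2 ^ t := by ring
  let B : Matrix (Fin a) (Fin q) ℤ := Matrix.of fun i j => -powTwoInd (i + (a + j))
  let C : Matrix (Fin q) (Fin a) ℤ := Matrix.of fun i j => -powTwoInd (a + i + j)
  let X : Matrix (Fin q) (Fin a) ℤ := Matrix.of fun j i =>
    if 2 ^ t ≤ a + j.1 then powTwoInd (2 ^ (t + 1) - (a + j) + i) else 0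
  have hblocks : (cornerMatrix c (a + q)).submatrix finSumFinEquiv finSumFinEquiv =
      Matrix.fromBlocks (cornerMatrix c a) B C (tailBlock a q) := by
    ext i j
    rcases i with i | i <;> rcases j with j | j <;>
      simp [cornerMatrix, cornerEntry, tailBlock, B, C, ha.ne']
  have hDX : tailBlock a q * X = C := by
    ext l i
    rw [Matrix.mul_apply, Finset.sum_eq_single l.rev]
    · simp only [tailBlock, X, C, Matrix.of_apply, Fin.val_rev]
      rw [show a + l.1 + (a + (q - (l.1 + 1))) = 2 ^ (t + 1) by omega, powTwoInd_two_pow]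
      split_ifs with hl
      · rw [show 2 ^ (t + 1) - (a + (q - (l.1 + 1))) + i.1 = a + l.1 + i.1 by omega]
        ring
      · rw [powTwoInd_eq_zero (t := t) (by omega) (by omega)]
        ring
    · intro j _ hj
      have hj' : j.1 ≠ q - (l.1 + 1) := fun h0 => hj (Fin.ext (by rw [h0, Fin.val_rev]))
      simp only [tailBlock, X, Matrix.of_apply]
      split_ifs with hjt
      · have hzero : powTwoInd (a + l.1 + (a + j.1)) = 0 := by
          rcases lt_or_gt_of_ne hj' with hlt | hgt
          · exact powTwoInd_eq_zero (t := t) (by omega) (by omega)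
          · exact powTwoInd_eq_zero (t := t + 1) (by omega) (by rw [pow_succ 2 (t + 1)]; omega)
        rw [hzero]
        ring
      · ring
    · simp
  have hBX : cornerMatrix c a - B * X = cornerMatrix (c + 1) a := by
    ext i' i
    have hlt : 2 ^ t - a < q := by omega
    have hsum : (B * X) i' i = if i'.1 = 0 ∧ i.1 = 0 then -1 else 0 := by
      rw [Matrix.mul_apply, Finset.sum_eq_single ⟨2 ^ t - a, hlt⟩]
      · simp only [B, X, Matrix.of_apply]
        rw [if_pos (by omega), show a + (2 ^ t - a) = 2 ^ t by omega,
          show 2 ^ (t + 1) - 2 ^ t = 2 ^ t by omega]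
        have hind (k : Fin a) : powTwoInd (k + 2 ^ t) = if k.1 = 0 then 1 else 0 := by
          split_ifs with hk
          · rw [hk, zero_add, powTwoInd_two_pow]
          · exact powTwoInd_eq_zero (t := t) (by omega) (by omega)
        rw [hind, add_comm, hind]
        split_ifs <;> simp_all
      · intro j _ hj
        have hj' : j.1 ≠ 2 ^ t - a := fun h0 => hj (Fin.ext h0)
        simp only [B, X, Matrix.of_apply]
        split_ifs with hjt
        · rw [powTwoInd_eq_zero (t := t) (n := i'.1 + (a + j.1)) (by omega) (by omega)]
          ring
        · ring
      · simp
    rw [Matrix.sub_apply, hsum]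
    simp only [cornerMatrix, cornerEntry, Matrix.of_apply]
    split_ifs <;> ring
  have hmul : Matrix.fromBlocks (cornerMatrix c a) B C (tailBlock a q) *
      Matrix.fromBlocks 1 0 (-X) 1 =
      Matrix.fromBlocks (cornerMatrix (c + 1) a) B 0 (tailBlock a q) := by
    rw [Matrix.fromBlocks_multiply, ← hBX]
    simp [hDX, sub_eq_add_neg]
  have hdet := congrArg Matrix.det hmul
  rw [Matrix.det_mul, Matrix.det_fromBlocks_zero₁₂, Matrix.det_fromBlocks_zero₂₁,
    ← hblocks, Matrix.det_submatrix_equiv_self] at hdet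
  simpa [mul_comm] using hdet

theorem exists_det_cornerMatrix (m : ℕ) :
    ∃ (ε : ℤ) (s : ℕ), (ε = 1 ∨ ε = -1) ∧ ∀ c, (cornerMatrix c (m + 1)).det = ε * (c + s) := by
  induction m using Nat.strong_induction_on with
  | _ m ih =>
    rcases Nat.eq_zero_or_pos m with rfl | hm
    · exact ⟨1, 0, Or.inl rfl, fun c => by simp [cornerMatrix, cornerEntry, powTwoInd_zero]⟩
    · obtain ⟨t, ht₁, ht₂⟩ : ∃ t, 2 ^ t ≤ m ∧ m < 2 ^ (t + 1) :=
        ⟨Nat.log 2 m, Nat.pow_log_le_self 2 hm.ne', Nat.lt_pow_succ_log_self (by norm_num) m⟩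
      have hpow : 2 ^ (t + 1) = 2 * 2 ^ t := by ring
      obtain ⟨ε, s, hε, hs⟩ := ih (2 ^ (t + 1) - m - 1) (by omega)
      rw [show 2 ^ (t + 1) - m - 1 + 1 = 2 ^ (t + 1) - m by omega] at hs
      refine ⟨(tailBlock (2 ^ (t + 1) - m) (2 * m + 1 - 2 ^ (t + 1))).det * ε, s + 1, ?_,
        fun c => ?_⟩
      · rcases det_tailBlock (t := t) (a := 2 ^ (t + 1) - m) (q := 2 * m + 1 - 2 ^ (t + 1))
          (by omega) (by omega) with hd | hd <;> rcases hε with rfl | rfl <;> simp [hd]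
      · rw [show m + 1 = 2 ^ (t + 1) - m + (2 * m + 1 - 2 ^ (t + 1)) by omega,
          det_cornerMatrix_add (t := t) (by omega) (by omega) (by omega), hs]
        push_cast
        ring

theorem stmt10 :
    ∀ n : ℕ, 1 ≤ n → h n ≠ 0 ∧ isign (h n) = g (n - 1) := by
  intro n hn
  obtain ⟨m, rfl⟩ : ∃ m, n = m + 1 := ⟨n - 1, by omega⟩
  obtain ⟨ε, s, hε, hs⟩ := exists_det_cornerMatrix m
  rw [Nat.add_sub_cancel, ← det_cornerMatrix_one_sub_zero, h_eq_det_cornerMatrix, hs, hs]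
  unfold isign
  rcases hε with rfl | rfl
  · rw [if_pos (by omega)]
    omega
  · rw [if_neg (by omega)]
    omega
end

section
/- (Barry's Conjecture 6.) Let h_n be the n-th Hankel determinant of the coefficient sequence of B(x) = 1 - x·r(x). Then for every n ≥ 0, |h_{n+1}| = s_n. -/
theorem powTwoInd_two_mul (n : ℕ) : powTwoInd (2 * n) = powTwoInd n := by
  have key : (∃ m : ℕ, 2 * n = 2 ^ m) ↔ ∃ m : ℕ, n = 2 ^ m := by
    constructor
    · rintro ⟨_ | m, hm⟩
      · omega
      · exact ⟨m, by rw [pow_succ] at hm; omega⟩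
    · rintro ⟨m, hm⟩
      exact ⟨m + 1, by rw [pow_succ]; omega⟩
  classical exact if_congr key rfl rfl

theorem powTwoInd_two_mul_add_one (n : ℕ) :
    powTwoInd (2 * n + 1) = if n = 0 then 1 else 0 := by
  have key : (∃ m : ℕ, 2 * n + 1 = 2 ^ m) ↔ n = 0 := by
    constructor
    · rintro ⟨_ | m, hm⟩
      · simpa using hm
      · rw [pow_succ] at hm; omega
    · rintro rfl
      exact ⟨0, rfl⟩
  classical exact if_congr key rfl rfl

theorem bseq_eq (n : ℕ) (hn : n ≠ 0) : bseq n = -powTwoInd n := by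
  obtain ⟨n, rfl⟩ := Nat.exists_eq_succ_of_ne_zero hn
  have key : (∃ m : ℕ, n = 2 ^ m - 1) ↔ ∃ m : ℕ, n + 1 = 2 ^ m := by
    refine exists_congr fun m => ?_
    have := Nat.one_le_two_pow (n := m)
    omega
  classical exact congrArg Neg.neg (if_congr key rfl rfl)

theorem sum_range_two_mul (f : ℕ → ℤ) (n : ℕ) :
    ∑ k ∈ Finset.range (2 * n), f k = ∑ k ∈ Finset.range n, (f (2 * k) + f (2 * k + 1)) := by
  induction n with
  | zero => simp
  | succ n ih =>
    rw [show 2 * (n + 1) = 2 * n + 1 + 1 by ring, Finset.sum_range_succ, Finset.sum_range_succ,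
      Finset.sum_range_succ, ih]
    ring

theorem sum_range_eq_of_support (f : ℕ → ℤ) {a m n : ℕ} (hf : ∀ k, a < k → f k = 0)
    (hm : a < m) (hn : a < n) : ∑ k ∈ Finset.range m, f k = ∑ k ∈ Finset.range n, f k := by
  have key : ∀ n, a < n → ∑ k ∈ Finset.range n, f k = ∑ k ∈ Finset.range (a + 1), f k :=
    fun n hn => Finset.eventually_constant_sum (fun k hk => hf k hk) hn
  rw [key m hm, key n hn]

theorem j_mul_self (k : ℕ) (hk : k ≠ 0) : j k * j k = 1 := by
  induction k using Nat.strong_induction_on with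
  | _ k ih =>
    obtain ⟨c, rfl | rfl⟩ := Nat.even_or_odd' k
    · rw [j_two_mul]
      exact ih c (by omega) (by omega)
    · rw [j_two_mul_add_one, ← mul_pow]
      simp

theorem s_two_mul_add_one_s12 (n : ℕ) :
    s (2 * n + 1) = s n + if Even n then 1 else 0 := by
  have alt : ∀ n : ℕ, ∑ k ∈ Finset.range (n + 1), (-1 : ℤ) ^ k = if Even n then 1 else 0 := by
    intro n
    rw [neg_one_geom_sum]
    by_cases hn : Even n <;> simp [Nat.even_add_one, hn]
  rw [s, s, show 2 * n + 1 + 1 = 2 * (n + 1) by ring, sum_range_two_mul, Finset.sum_add_distrib]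
  simp only [j_two_mul, j_two_mul_add_one, alt]
  ring

theorem s_two_mul (n : ℕ) : s (2 * n) = s n + if Even n then 0 else 1 := by
  have h₁ := s_two_mul_add_one_s12 n
  have h₂ : s (2 * n + 1) = s (2 * n) + (-1) ^ n := by
    rw [s, Finset.sum_range_succ, j_two_mul_add_one, s]
    ring
  rcases Nat.even_or_odd n with hn | hn
  · simp only [hn, if_true, hn.neg_one_pow] at *
    linarith
  · simp only [Nat.not_even_iff_odd.mpr hn, if_false, hn.neg_one_pow] at *
    linarith

theorem s_pos (n : ℕ) : 0 < s n := by
  induction n using Nat.strong_induction_on with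
  | _ n ih =>
    obtain ⟨c, rfl | rfl⟩ := Nat.even_or_odd' n
    · rcases Nat.eq_zero_or_pos c with rfl | hc
      · simp [s, j]
      · have := ih c (by omega)
        rw [s_two_mul]
        split_ifs <;> linarith
    · have := ih c (by omega)
      rw [s_two_mul_add_one_s12]
      split_ifs <;> linarith

/-- Tail sums of the rows of `rueppelFactor`. -/
def rueppelTail : ℕ → ℕ → ℤ
  | 0, m => if m = 0 then 1 else 0
  | (a + 1), m =>
      if (a + 1) % 2 = 0 then
        if m % 2 = 0 then rueppelTail ((a + 1) / 2) (m / 2) else 0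
      else
        if m % 2 = 0 then 0
        else -(-1) ^ (m / 2) *
          (rueppelTail ((a + 1) / 2) (m / 2) - rueppelTail ((a + 1) / 2) (m / 2 + 1))
decreasing_by all_goals omega

/-- Lower triangular matrix `A` such that `A * diag((-1)^m) * Aᵀ` is the Hankel matrix of the
Rueppel sequence. -/
def rueppelFactor (a m : ℕ) : ℤ := rueppelTail a m - rueppelTail a (m + 1)

theorem rueppelTail_even_even (a m : ℕ) : rueppelTail (2 * a) (2 * m) = rueppelTail a m := by
  rcases a with _ | a
  · simp [rueppelTail]
  · rw [show 2 * (a + 1) = (2 * a + 1) + 1 by ring, rueppelTail, if_pos (by omega),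
      if_pos (by omega)]
    congr 1 <;> omega

theorem rueppelTail_even_odd (a m : ℕ) : rueppelTail (2 * a) (2 * m + 1) = 0 := by
  rcases a with _ | a
  · simp [rueppelTail]
  · rw [show 2 * (a + 1) = (2 * a + 1) + 1 by ring, rueppelTail, if_pos (by omega),
      if_neg (by omega)]

theorem rueppelTail_odd_even (a m : ℕ) : rueppelTail (2 * a + 1) (2 * m) = 0 := by
  rw [rueppelTail, if_neg (by omega), if_pos (by omega)]

theorem rueppelTail_odd_odd (a m : ℕ) :
    rueppelTail (2 * a + 1) (2 * m + 1) = -(-1) ^ m * rueppelFactor a m := by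
  rw [rueppelTail, if_neg (by omega), if_neg (by omega), rueppelFactor,
    show (2 * a + 1) / 2 = a by omega, show (2 * m + 1) / 2 = m by omega]

theorem rueppelFactor_even_even (a m : ℕ) :
    rueppelFactor (2 * a) (2 * m) = rueppelTail a m := by
  rw [rueppelFactor, rueppelTail_even_even, rueppelTail_even_odd, sub_zero]

theorem rueppelFactor_even_odd (a m : ℕ) :
    rueppelFactor (2 * a) (2 * m + 1) = -rueppelTail a (m + 1) := by
  rw [rueppelFactor, rueppelTail_even_odd, show 2 * m + 1 + 1 = 2 * (m + 1) by ring,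
    rueppelTail_even_even, zero_sub]

theorem rueppelFactor_odd_even (a m : ℕ) :
    rueppelFactor (2 * a + 1) (2 * m) = (-1) ^ m * rueppelFactor a m := by
  rw [rueppelFactor, rueppelTail_odd_even, rueppelTail_odd_odd]
  ring

theorem rueppelFactor_odd_odd (a m : ℕ) :
    rueppelFactor (2 * a + 1) (2 * m + 1) = -(-1) ^ m * rueppelFactor a m := by
  rw [rueppelFactor, rueppelTail_odd_odd, show 2 * m + 1 + 1 = 2 * (m + 1) by ring,
    rueppelTail_odd_even, sub_zero]

theorem rueppelTail_eq_zero (a m : ℕ) (ham : a < m) : rueppelTail a m = 0 := by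
  induction a using Nat.strong_induction_on generalizing m with
  | _ a ih =>
    obtain ⟨c, rfl | rfl⟩ := Nat.even_or_odd' a <;> obtain ⟨d, rfl | rfl⟩ := Nat.even_or_odd' m
    · rcases Nat.eq_zero_or_pos c with rfl | hc
      · simp [rueppelTail, show d ≠ 0 by omega]
      · rw [rueppelTail_even_even, ih c (by omega) d (by omega)]
    · exact rueppelTail_even_odd c d
    · exact rueppelTail_odd_even c d
    · rw [rueppelTail_odd_odd, rueppelFactor, ih c (by omega) d (by omega),
        ih c (by omega) (d + 1) (by omega)]
      simp

theorem rueppelFactor_eq_zero (a m : ℕ) (ham : a < m) : rueppelFactor a m = 0 := by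
  rw [rueppelFactor, rueppelTail_eq_zero a m ham, rueppelTail_eq_zero a (m + 1) (by omega),
    sub_zero]

theorem rueppelTail_zero_right (a : ℕ) : rueppelTail a 0 = if a = 0 then 1 else 0 := by
  induction a using Nat.strong_induction_on with
  | _ a ih =>
    obtain ⟨c, rfl | rfl⟩ := Nat.even_or_odd' a
    · rcases Nat.eq_zero_or_pos c with rfl | hc
      · simp [rueppelTail]
      · have := rueppelTail_even_even c 0
        rw [mul_zero] at this
        rw [this, ih c (by omega)]
        simp
    · have := rueppelTail_odd_even c 0
      rw [mul_zero] at this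
      simp [this]

theorem abs_rueppelTail_self (a : ℕ) : |rueppelTail a a| = 1 := by
  induction a using Nat.strong_induction_on with
  | _ a ih =>
    obtain ⟨c, rfl | rfl⟩ := Nat.even_or_odd' a
    · rcases Nat.eq_zero_or_pos c with rfl | hc
      · simp [rueppelTail]
      · rw [rueppelTail_even_even, ih c (by omega)]
    · rw [rueppelTail_odd_odd, rueppelFactor, rueppelTail_eq_zero c (c + 1) (by omega)]
      simp [abs_mul, ih c (by omega)]

theorem abs_rueppelFactor_self (a : ℕ) : |rueppelFactor a a| = 1 := by
  rw [rueppelFactor, rueppelTail_eq_zero a (a + 1) (by omega), sub_zero, abs_rueppelTail_self]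

theorem rueppelFactor_zero_right (a : ℕ) : rueppelFactor a 0 = powTwoInd (a + 1) := by
  induction a using Nat.strong_induction_on with
  | _ a ih =>
    obtain ⟨c, rfl | rfl⟩ := Nat.even_or_odd' a
    · have := rueppelFactor_even_even c 0
      rw [mul_zero] at this
      rw [this, powTwoInd_two_mul_add_one, rueppelTail_zero_right]
    · rw [← mul_zero 2, rueppelFactor_odd_even, pow_zero, one_mul, ih c (by omega),
        show 2 * c + 1 + 1 = 2 * (c + 1) by ring, powTwoInd_two_mul]

theorem sum_rueppelFactor (a n : ℕ) (han : a < n) :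
    ∑ m ∈ Finset.range n, rueppelFactor a m = if a = 0 then 1 else 0 := by
  simp only [rueppelFactor]
  rw [Finset.sum_range_sub', rueppelTail_eq_zero a n han, rueppelTail_zero_right, sub_zero]

theorem sum_rueppelFactor_mul (a b n : ℕ) (han : a < n) :
    ∑ m ∈ Finset.range n, (-1) ^ m * rueppelFactor a m * rueppelFactor b m
      = powTwoInd (a + b + 1) := by
  induction a using Nat.strong_induction_on generalizing b n with
  | _ a ih =>
    have bound : a < 2 * (a / 2 + 1) := by omega
    rw [sum_range_eq_of_support _ (fun k hk => by rw [rueppelFactor_eq_zero a k hk]; ring)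
      han bound, sum_range_two_mul]
    have pow_even : ∀ m : ℕ, (-1 : ℤ) ^ (2 * m) = 1 := fun m => by simp
    have pow_odd : ∀ m : ℕ, (-1 : ℤ) ^ (2 * m + 1) = -1 := fun m => by simp [pow_succ]
    obtain ⟨c, hc⟩ := Nat.even_or_odd' a
    have hac : a / 2 = c := by omega
    rw [hac]
    obtain ⟨d, hd⟩ := Nat.even_or_odd' b
    rcases hc with rfl | rfl <;> rcases hd with rfl | rfl
    · simp only [rueppelFactor_even_even, rueppelFactor_even_odd, pow_even, pow_odd]
      have tele := Finset.sum_range_sub' (fun m => rueppelTail c m * rueppelTail d m) (c + 1)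
      rw [rueppelTail_eq_zero c (c + 1) (by omega), rueppelTail_zero_right,
        rueppelTail_zero_right] at tele
      rw [show 2 * c + 2 * d + 1 = 2 * (c + d) + 1 by ring, powTwoInd_two_mul_add_one]
      trans ∑ m ∈ Finset.range (c + 1), (rueppelTail c m * rueppelTail d m
        - rueppelTail c (m + 1) * rueppelTail d (m + 1))
      · exact Finset.sum_congr rfl fun m _ => by ring
      · rw [tele]
        by_cases hc : c = 0 <;> by_cases hd : d = 0 <;> simp [hc, hd]
    · rw [show 2 * c + (2 * d + 1) + 1 = 2 * (c + d + 1) by ring,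
        powTwoInd_two_mul]
      simp only [rueppelFactor_even_even, rueppelFactor_even_odd, rueppelFactor_odd_even,
        rueppelFactor_odd_odd, pow_even, pow_odd]
      trans ∑ m ∈ Finset.range (c + 1), (-1) ^ m * rueppelFactor c m * rueppelFactor d m
      · refine Finset.sum_congr rfl fun m _ => ?_
        rw [show rueppelFactor c m = rueppelTail c m - rueppelTail c (m + 1) from rfl]
        ring
      · rcases Nat.eq_zero_or_pos c with rfl | hc
        · have : rueppelFactor 0 0 = 1 := by simp [rueppelFactor, rueppelTail]
          simp [this, rueppelFactor_zero_right]
        · exact ih c (by omega) d (c + 1) (by omega)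
    · rw [show 2 * c + 1 + 2 * d + 1 = 2 * (c + d + 1) by ring,
        powTwoInd_two_mul, ← ih c (by omega) d (c + 1) (by omega)]
      simp only [rueppelFactor_even_even, rueppelFactor_even_odd, rueppelFactor_odd_even,
        rueppelFactor_odd_odd, pow_even, pow_odd]
      refine Finset.sum_congr rfl fun m _ => ?_
      rw [show rueppelFactor d m = rueppelTail d m - rueppelTail d (m + 1) from rfl]
      ring
    · rw [show 2 * c + 1 + (2 * d + 1) + 1 = 2 * (c + d + 1) + 1 by ring,
        powTwoInd_two_mul_add_one, if_neg (by omega)]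
      simp only [rueppelFactor_odd_even, rueppelFactor_odd_odd, pow_even, pow_odd]
      exact Finset.sum_eq_zero fun m _ => by ring

/-- Lower triangular matrix `L` such that, on positive indices, `L * diag(j) * Lᵀ` has entries
`powTwoInd (i + k)` and `L` has row sums `powTwoInd i`. -/
def powTwoFactor : ℕ → ℕ → ℤ
  | 0, m => if m = 0 then 1 else 0
  | (a + 1), m =>
      if (a + 1) % 2 = 0 then
        if m % 2 = 0 then powTwoFactor ((a + 1) / 2) (m / 2) else 0
      else
        if m % 2 = 0 then 0 else rueppelFactor ((a + 1) / 2) (m / 2)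
decreasing_by omega

theorem powTwoFactor_even_even (a m : ℕ) :
    powTwoFactor (2 * a) (2 * m) = powTwoFactor a m := by
  rcases a with _ | a
  · simp [powTwoFactor]
  · rw [show 2 * (a + 1) = (2 * a + 1) + 1 by ring, powTwoFactor, if_pos (by omega),
      if_pos (by omega)]
    congr 1 <;> omega

theorem powTwoFactor_even_odd (a m : ℕ) : powTwoFactor (2 * a) (2 * m + 1) = 0 := by
  rcases a with _ | a
  · simp [powTwoFactor]
  · rw [show 2 * (a + 1) = (2 * a + 1) + 1 by ring, powTwoFactor, if_pos (by omega),
      if_neg (by omega)]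

theorem powTwoFactor_odd_even (a m : ℕ) : powTwoFactor (2 * a + 1) (2 * m) = 0 := by
  rw [powTwoFactor, if_neg (by omega), if_pos (by omega)]

theorem powTwoFactor_odd_odd (a m : ℕ) :
    powTwoFactor (2 * a + 1) (2 * m + 1) = rueppelFactor a m := by
  rw [powTwoFactor, if_neg (by omega), if_neg (by omega)]
  congr 1 <;> omega

theorem powTwoFactor_eq_zero (a m : ℕ) (ham : a < m) : powTwoFactor a m = 0 := by
  induction a using Nat.strong_induction_on generalizing m with
  | _ a ih =>
    obtain ⟨c, rfl | rfl⟩ := Nat.even_or_odd' a <;> obtain ⟨d, rfl | rfl⟩ := Nat.even_or_odd' m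
    · rcases Nat.eq_zero_or_pos c with rfl | hc
      · simp [powTwoFactor, show d ≠ 0 by omega]
      · rw [powTwoFactor_even_even, ih c (by omega) d (by omega)]
    · exact powTwoFactor_even_odd c d
    · exact powTwoFactor_odd_even c d
    · rw [powTwoFactor_odd_odd, rueppelFactor_eq_zero c d (by omega)]

theorem powTwoFactor_zero_right (a : ℕ) (ha : a ≠ 0) : powTwoFactor a 0 = 0 := by
  induction a using Nat.strong_induction_on with
  | _ a ih =>
    obtain ⟨c, rfl | rfl⟩ := Nat.even_or_odd' a
    · rw [← mul_zero 2, powTwoFactor_even_even, ih c (by omega) (by omega)]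
    · rw [← mul_zero 2, powTwoFactor_odd_even]

theorem abs_powTwoFactor_self (a : ℕ) : |powTwoFactor a a| = 1 := by
  induction a using Nat.strong_induction_on with
  | _ a ih =>
    obtain ⟨c, rfl | rfl⟩ := Nat.even_or_odd' a
    · rcases Nat.eq_zero_or_pos c with rfl | hc
      · simp [powTwoFactor]
      · rw [powTwoFactor_even_even, ih c (by omega)]
    · rw [powTwoFactor_odd_odd, abs_rueppelFactor_self]

theorem sum_powTwoFactor (a n : ℕ) (ha : a ≠ 0) (han : a < n) :
    ∑ m ∈ Finset.range n, powTwoFactor a m = powTwoInd a := by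
  induction a using Nat.strong_induction_on generalizing n with
  | _ a ih =>
    have bound : a < 2 * (a / 2 + 1) := by omega
    rw [sum_range_eq_of_support _ (powTwoFactor_eq_zero a) han bound, sum_range_two_mul]
    obtain ⟨c, hc⟩ := Nat.even_or_odd' a
    have hac : a / 2 = c := by omega
    rw [hac]
    rcases hc with rfl | rfl
    · simp only [powTwoFactor_even_even, powTwoFactor_even_odd, add_zero]
      rw [ih c (by omega) (c + 1) (by omega) (by omega), powTwoInd_two_mul]
    · simp only [powTwoFactor_odd_even, powTwoFactor_odd_odd, zero_add]
      rw [sum_rueppelFactor c (c + 1) (by omega), powTwoInd_two_mul_add_one]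

theorem sum_powTwoFactor_mul (a b n : ℕ) (ha : a ≠ 0) (hb : b ≠ 0) (han : a < n) :
    ∑ m ∈ Finset.range n, powTwoFactor a m * j m * powTwoFactor b m = powTwoInd (a + b) := by
  induction a using Nat.strong_induction_on generalizing b n with
  | _ a ih =>
    have bound : a < 2 * (a / 2 + 1) := by omega
    rw [sum_range_eq_of_support _ (fun k hk => by rw [powTwoFactor_eq_zero a k hk]; ring)
      han bound, sum_range_two_mul]
    obtain ⟨c, hc⟩ := Nat.even_or_odd' a
    have hac : a / 2 = c := by omega
    rw [hac]
    obtain ⟨d, hd⟩ := Nat.even_or_odd' b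
    rcases hc with rfl | rfl <;> rcases hd with rfl | rfl
    · simp only [powTwoFactor_even_even, powTwoFactor_even_odd, j_two_mul, mul_zero, add_zero]
      rw [ih c (by omega) d (c + 1) (by omega) (by omega) (by omega), ← mul_add,
        powTwoInd_two_mul]
    · rw [← add_assoc, ← mul_add, powTwoInd_two_mul_add_one, if_neg (by omega)]
      simp [powTwoFactor_even_odd, powTwoFactor_odd_even]
    · rw [add_right_comm, ← mul_add, powTwoInd_two_mul_add_one, if_neg (by omega)]
      simp [powTwoFactor_even_odd, powTwoFactor_odd_even]
    · rw [show 2 * c + 1 + (2 * d + 1) = 2 * (c + d + 1) by ring,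
        powTwoInd_two_mul, ← sum_rueppelFactor_mul c d (c + 1) (by omega)]
      simp only [powTwoFactor_odd_even, powTwoFactor_odd_odd, j_two_mul_add_one]
      exact Finset.sum_congr rfl fun m _ => by ring

/-- The arrowhead matrix with first row and column `(1, -1, -1, …)` and diagonal `-j k`. -/
def arrowhead (n : ℕ) : Matrix (Fin (n + 1)) (Fin (n + 1)) ℤ :=
  Matrix.of fun i k =>
    if i = 0 then if k = 0 then 1 else -1
    else if k = 0 then -1 else if i = k then -j i else 0

/-- The leading block of `powTwoFactor`. -/
def powTwoFactorMatrix (n : ℕ) : Matrix (Fin (n + 1)) (Fin (n + 1)) ℤ :=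
  Matrix.of fun i k => powTwoFactor i k

theorem abs_det_powTwoFactorMatrix (n : ℕ) : |(powTwoFactorMatrix n).det| = 1 := by
  rw [Matrix.det_of_isLowerTriangular]
  · rw [Finset.abs_prod]
    exact Finset.prod_eq_one fun i _ => abs_powTwoFactor_self i
  · intro i k hik
    exact powTwoFactor_eq_zero _ _ hik

theorem abs_det_arrowhead (n : ℕ) : |(arrowhead n).det| = |s n| := by
  let V : Matrix (Fin (n + 1)) (Fin (n + 1)) ℤ :=
    Matrix.of fun i k => if i = k then 1 else if k = 0 then -j i else 0
  have hV : V.det = 1 := by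
    rw [Matrix.det_of_isLowerTriangular]
    · simp [V]
    · intro i k hik
      have hik : i < k := hik
      have : k ≠ 0 := (lt_of_le_of_lt (Fin.zero_le i) hik).ne'
      simp [V, hik.ne, this]
  have hsum : s n = 1 + ∑ i : Fin n, j (i.1 + 1) := by
    rw [s, Finset.sum_range_succ', Finset.sum_range (fun k => j (k + 1))]
    simp [j]
  have mul_zero_zero : (arrowhead n * V) 0 0 = s n := by
    rw [hsum, Matrix.mul_apply, Fin.sum_univ_succ]
    simp [arrowhead, V, Fin.succ_ne_zero]
  have mul_succ_zero : ∀ i : Fin n, (arrowhead n * V) i.succ 0 = 0 := by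
    intro i
    have := j_mul_self (i.1 + 1) (by omega)
    rw [Matrix.mul_apply, Fin.sum_univ_succ]
    simp [arrowhead, V, Fin.succ_ne_zero, this]
  have mul_succ : ∀ (i : Fin (n + 1)) (k : Fin n),
      (arrowhead n * V) i k.succ = arrowhead n i k.succ := by
    intro i k
    rw [Matrix.mul_apply]
    simp [V, Fin.succ_ne_zero]
  rw [← mul_one (arrowhead n).det, ← hV, ← Matrix.det_mul, Matrix.det_of_isUpperTriangular,
    Fin.prod_univ_succ, mul_zero_zero, abs_mul, Finset.abs_prod, Finset.prod_eq_one, mul_one]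
  · intro i _
    have := j_mul_self (i.1 + 1) (by omega)
    rw [mul_succ]
    simp only [arrowhead, Matrix.of_apply, Fin.succ_ne_zero, if_false, if_true, abs_neg,
      Fin.val_succ]
    exact abs_eq_abs.mpr (by simpa using mul_self_eq_one_iff.mp this)
  · intro i k hik
    have hik : k < i := hik
    obtain ⟨i, rfl⟩ := Fin.exists_succ_eq.mpr (lt_of_le_of_lt (Fin.zero_le k) hik).ne'
    refine Fin.cases (fun _ => mul_succ_zero i) (fun k hik => ?_) k hik
    rw [mul_succ]
    simp [arrowhead, Fin.succ_ne_zero, hik.ne']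

theorem hankelMatrix_bseq (n : ℕ) :
    (Matrix.of fun i k : Fin (n + 1) => bseq (i.1 + k.1)) =
      powTwoFactorMatrix n * arrowhead n * (powTwoFactorMatrix n).transpose := by
  have row_sum : ∀ i : Fin n, ∑ l : Fin n, powTwoFactor (i + 1) (l + 1) = powTwoInd (i + 1) := by
    intro i
    rw [← sum_powTwoFactor (i + 1) (n + 1) (by omega) (by omega), Finset.sum_range_succ',
      powTwoFactor_zero_right _ (by omega), add_zero, Finset.sum_range]
  have form : ∀ i k : Fin n, ∑ l : Fin n, powTwoFactor (i + 1) (l + 1) * j (l + 1) *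
      powTwoFactor (k + 1) (l + 1) = powTwoInd (i + 1 + (k + 1)) := by
    intro i k
    rw [← sum_powTwoFactor_mul (i + 1) (k + 1) (n + 1) (by omega) (by omega) (by omega),
      Finset.sum_range_succ', powTwoFactor_zero_right _ (by omega), zero_mul, zero_mul, add_zero,
      Finset.sum_range]
  have zero_row : ∀ k : ℕ, powTwoFactor 0 k = if k = 0 then 1 else 0 := fun k => by
    rw [powTwoFactor]
  ext i k
  rw [Matrix.of_apply]
  refine Fin.cases ?_ (fun i => ?_) i <;> refine Fin.cases ?_ (fun k => ?_) k
  · simp [Matrix.mul_apply, Fin.sum_univ_succ, powTwoFactorMatrix, arrowhead, zero_row, bseq]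
  · rw [bseq_eq _ (by simp)]
    simp [Matrix.mul_apply, Fin.sum_univ_succ, powTwoFactorMatrix, arrowhead, zero_row,
      powTwoFactor_zero_right, ← row_sum, Fin.succ_ne_zero]
  · rw [bseq_eq _ (by simp)]
    simp [Matrix.mul_apply, Fin.sum_univ_succ, powTwoFactorMatrix, arrowhead, zero_row,
      powTwoFactor_zero_right, ← row_sum, Fin.succ_ne_zero]
  · rw [bseq_eq _ (by simp)]
    simp [Matrix.mul_apply, Fin.sum_univ_succ, powTwoFactorMatrix, arrowhead,
      powTwoFactor_zero_right, ← form, Fin.succ_ne_zero]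

theorem stmt12 : ∀ n : ℕ, |h (n + 1)| = s n := by
  intro n
  rw [h, hankel, hankelMatrix_bseq, Matrix.det_mul, Matrix.det_mul, Matrix.det_transpose, abs_mul,
    abs_mul, abs_det_powTwoFactorMatrix, abs_det_arrowhead, one_mul, mul_one,
    abs_of_pos (s_pos n)]
end

section
/- (Barry's Conjecture 8.) Let h_n be the n-th Hankel determinant of the coefficient sequence of B(x) = 1 - x·r(x), and for n ≥ 1 define u_n = |sign(h_{n+1}) - sign(h_n)|/2. Then (u_n)_{n≥1} is the paperfolding sequence on {0,1}; that is, u_{2n} = u_n for all n ≥ 1, u_{4n+1} = 1 for all n ≥ 0, and u_{4n+3} = 0 for all n ≥ 0. -/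
/-- `u n = |sign (h (n+1)) - sign (h n)| / 2`. -/
noncomputable def u (n : ℕ) : ℤ := |isign (h (n + 1)) - isign (h n)| / 2

open scoped Classical in
/-- The sequence with value `x` at `0`, `-1` at powers of two, and `0` elsewhere. -/
noncomputable def negPowTwoSeq (x : ℤ) (n : ℕ) : ℤ :=
  if n = 0 then x else if ∃ k : ℕ, n = 2 ^ k then -1 else 0

lemma bseq_eq_negPowTwoSeq : bseq = negPowTwoSeq 1 := by
  funext n
  cases n with
  | zero => simp [bseq, negPowTwoSeq]
  | succ n =>
    have key : (∃ m : ℕ, n = 2 ^ m - 1) ↔ ∃ k : ℕ, n + 1 = 2 ^ k := by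
      refine exists_congr fun m => ?_
      have := Nat.one_le_two_pow (n := m)
      omega
    simp only [bseq, ruep, negPowTwoSeq, key]
    split_ifs <;> simp_all

lemma negPowTwoSeq_two_pow (x : ℤ) (k : ℕ) : negPowTwoSeq x (2 ^ k) = -1 := by
  simp [negPowTwoSeq]

lemma negPowTwoSeq_eq_zero (x : ℤ) {k n : ℕ} (h₁ : 2 ^ k < n) (h₂ : n < 2 ^ (k + 1)) :
    negPowTwoSeq x n = 0 := by
  have h_not : ¬ ∃ l : ℕ, n = 2 ^ l := by
    rintro ⟨l, rfl⟩
    have := (Nat.pow_lt_pow_iff_right (by norm_num : 1 < 2)).1 h₁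
    have := (Nat.pow_lt_pow_iff_right (by norm_num : 1 < 2)).1 h₂
    omega
  rw [negPowTwoSeq, if_neg (by omega), if_neg h_not]

lemma sign_revPerm_succ (n : ℕ) :
    Equiv.Perm.sign (Fin.revPerm (n := n + 1)) =
      (-1) ^ n * Equiv.Perm.sign (Fin.revPerm (n := n)) := by
  have key (m : ℕ) : ((Equiv.Perm.sign (Fin.revPerm (n := m)) : ℤˣ) : ℤ) =
      ((1 : Matrix (Fin m) (Fin m) ℤ).submatrix Fin.revPerm id).det := by
    simp [Matrix.det_permute]
  apply Units.ext
  push_cast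
  rw [key, key, Matrix.det_succ_row_zero, Finset.sum_eq_single (Fin.last n)]
  · have : ((1 : Matrix (Fin (n + 1)) (Fin (n + 1)) ℤ).submatrix Fin.revPerm id).submatrix
        Fin.succ (Fin.last n).succAbove =
        (1 : Matrix (Fin n) (Fin n) ℤ).submatrix Fin.revPerm id := by
      ext i j
      simp [Matrix.one_apply, Fin.ext_iff, Fin.val_rev]
    have h_entry : (1 : Matrix (Fin (n + 1)) (Fin (n + 1)) ℤ) (Fin.revPerm 0) (Fin.last n) = 1 := by
      simp [Matrix.one_apply]
    rw [this, Matrix.submatrix_apply, id, h_entry]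
    simp
  · intro j _ hj
    simp [hj.symm]
  · simp

lemma sign_revPerm_odd (t : ℕ) :
    Equiv.Perm.sign (Fin.revPerm (n := 2 * t + 1)) = (-1) ^ t := by
  induction t with
  | zero => decide
  | succ t ih =>
    rw [sign_revPerm_succ, show 2 * (t + 1) = 2 * t + 1 + 1 by ring, sign_revPerm_succ, ih]
    simp [pow_succ, pow_mul]

/-- The index set of the central diagonal block. -/
def centralEquiv (q t : ℕ) (b : Fin q ⊕ Fin (2 * t + 1) → Fin (2 * t + 1))
    (hl : ∀ i, b (.inl i) = ⟨t, by omega⟩) (hr : ∀ i, b (.inr i) = i) :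
    Fin q ⊕ Unit ≃ {a // b a = ⟨t, by omega⟩} where
  toFun := Sum.elim (fun i => ⟨.inl i, hl i⟩) (fun _ => ⟨.inr ⟨t, by omega⟩, hr _⟩)
  invFun a := Sum.elim .inl (fun _ => .inr ()) a.1
  left_inv := by rintro (i | i) <;> rfl
  right_inv := by
    rintro ⟨i | i, hi⟩
    · rfl
    · rw [hr] at hi
      subst hi
      rfl

lemma hankel_negPowTwoSeq (x : ℤ) {q t k : ℕ} (hq : 0 < q) (hqt : q + t = 2 ^ k) :
    hankel (negPowTwoSeq x) (q + (2 * t + 1)) =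
      (-1) ^ (t + 1) * hankel (negPowTwoSeq (x + 1)) q := by
  have hk : 2 ^ (k + 1) = 2 * 2 ^ k := by ring
  have hk' : 2 ^ (k + 1 + 1) = 4 * 2 ^ k := by ring
  set r : Fin q ⊕ Fin (2 * t + 1) → ℕ := Sum.elim (fun i => i.1) (fun i => q + i.1) with hr
  set M : Matrix (Fin q ⊕ Fin (2 * t + 1)) (Fin q ⊕ Fin (2 * t + 1)) ℤ :=
    .of fun i j => negPowTwoSeq x (r i + r j) with hM
  have hdet : hankel (negPowTwoSeq x) (q + (2 * t + 1)) = M.det := by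
    rw [hankel, ← Matrix.det_submatrix_equiv_self finSumFinEquiv]
    congr 1
    ext (i | i) (j | j) <;> simp [hM, hr]
  set σ : Equiv.Perm (Fin q ⊕ Fin (2 * t + 1)) := Equiv.sumCongr (Equiv.refl _) Fin.revPerm with hσ
  have hsign : (M.submatrix id σ).det = (-1) ^ t * M.det := by
    rw [Matrix.det_permute', hσ]
    have : Equiv.Perm.sign (Equiv.sumCongr (Equiv.refl (Fin q)) (Fin.revPerm (n := 2 * t + 1))) =
        (-1) ^ t := by
      rw [← sign_revPerm_odd, ← one_mul (Equiv.Perm.sign Fin.revPerm),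
        ← Equiv.Perm.sign_refl (α := Fin q)]
      exact Equiv.Perm.sign_sumCongr _ _
    rw [this]
    simp
  set c : Fin (2 * t + 1) := ⟨t, by omega⟩ with hc
  set b : Fin q ⊕ Fin (2 * t + 1) → Fin (2 * t + 1) := Sum.elim (fun _ => c) id with hb
  have htri : (M.submatrix id σ).BlockTriangular b := by
    rintro (i | i) (j | j) hij
    · simp [hb] at hij
    all_goals
      have hi := i.2
      have hj := j.2
      simp only [hb, hc, Sum.elim_inl, Sum.elim_inr, id, Fin.lt_def] at hij
      simp only [hM, hr, hσ, Matrix.submatrix_apply, Matrix.of_apply, id, Equiv.sumCongr_apply,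
        Sum.map_inl, Sum.map_inr, Sum.elim_inl, Sum.elim_inr, Equiv.refl_apply,
        Fin.revPerm_apply, Fin.val_rev]
    · exact negPowTwoSeq_eq_zero x (k := k) (by omega) (by omega)
    · exact negPowTwoSeq_eq_zero x (k := k) (by omega) (by omega)
    · exact negPowTwoSeq_eq_zero x (k := k + 1) (by omega) (by omega)
  have hdiag (i : Fin (2 * t + 1)) : M.submatrix id σ (.inr i) (.inr i) = -1 := by
    have hi := i.2
    simp only [hM, hr, hσ, Matrix.submatrix_apply, Matrix.of_apply, id, Equiv.sumCongr_apply,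
      Sum.map_inr, Sum.elim_inr, Fin.revPerm_apply, Fin.val_rev]
    rw [← negPowTwoSeq_two_pow x (k + 1)]
    congr 1
    omega
  have hside (i : Fin q) : negPowTwoSeq x (2 ^ k + i) = if i.1 = 0 then -1 else 0 := by
    have hi := i.2
    split_ifs with h0
    · rw [h0, add_zero, negPowTwoSeq_two_pow]
    · exact negPowTwoSeq_eq_zero x (k := k) (by omega) (by omega)
  have hblock (i : Fin (2 * t + 1)) (hi : i ≠ c) :
      ((M.submatrix id σ).toSquareBlock b i).det = -1 := by
    let _ : Unique {a // b a = i} :=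
      { default := ⟨.inr i, rfl⟩
        uniq := by
          rintro ⟨j | j, hj⟩
          · exact absurd hj.symm hi
          · exact Subtype.ext (congrArg Sum.inr hj) }
    rw [Matrix.det_unique]
    exact hdiag i
  have hcentral : ((M.submatrix id σ).toSquareBlock b c).det =
      - hankel (negPowTwoSeq (x + 1)) q := by
    rw [← Matrix.det_submatrix_equiv_self
      (centralEquiv q t b (fun _ => rfl) (fun _ => rfl))]
    have hfrom : ((M.submatrix id σ).toSquareBlock b c).submatrix
        (centralEquiv q t b (fun _ => rfl) (fun _ => rfl))
        (centralEquiv q t b (fun _ => rfl) (fun _ => rfl)) =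
        Matrix.fromBlocks (.of fun i j : Fin q => negPowTwoSeq x (i.1 + j.1))
          (.of fun (i : Fin q) (_ : Unit) => if i.1 = 0 then -1 else 0)
          (.of fun (_ : Unit) (j : Fin q) => if j.1 = 0 then -1 else 0) (-1) := by
      ext (i | i) (j | j)
      · rfl
      · refine Eq.trans ?_ (hside i)
        simp only [centralEquiv, hM, hr, hσ, Matrix.toSquareBlock_def, Matrix.submatrix_apply,
          Matrix.of_apply, id, Equiv.coe_fn_mk, Equiv.sumCongr_apply, Sum.map_inr, Sum.elim_inl,
          Sum.elim_inr, Fin.revPerm_apply, Fin.val_rev]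
        congr 1
        omega
      · refine Eq.trans ?_ (hside j)
        simp only [centralEquiv, hM, hr, hσ, Matrix.toSquareBlock_def, Matrix.submatrix_apply,
          Matrix.of_apply, id, Equiv.coe_fn_mk, Equiv.sumCongr_apply, Sum.map_inl, Sum.elim_inl,
          Sum.elim_inr, Equiv.refl_apply]
        congr 1
        omega
      · exact hdiag c
    let _ : Invertible (-1 : Matrix Unit Unit ℤ) := ⟨-1, by simp, by simp⟩
    have hinv : ⅟(-1 : Matrix Unit Unit ℤ) = -1 := rfl
    rw [hfrom, Matrix.det_fromBlocks₂₂, hinv]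
    simp only [Matrix.det_unique, Matrix.neg_apply, Matrix.one_apply_eq,
      neg_mul, one_mul, hankel]
    congr 2
    ext i j
    simp only [Matrix.sub_apply, Matrix.of_apply, Matrix.mul_apply, Finset.univ_unique,
      Finset.sum_singleton, Matrix.neg_apply, negPowTwoSeq,
      Nat.add_eq_zero_iff, Matrix.mul_neg, Matrix.mul_one]
    by_cases hi : i.1 = 0 <;> by_cases hj : j.1 = 0 <;> simp [hi, hj]
  have hprod : (M.submatrix id σ).det = - hankel (negPowTwoSeq (x + 1)) q := by
    rw [htri.det_fintype, ← Finset.mul_prod_erase _ _ (Finset.mem_univ c), hcentral,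
      Finset.prod_congr rfl fun i hi => hblock i (Finset.ne_of_mem_erase hi)]
    simp
  have hsq : ((-1 : ℤ) ^ t) * (-1) ^ t = 1 := by rw [← mul_pow]; simp
  rw [hdet, pow_succ]
  linear_combination (-1) ^ t * (hprod - hsign) - M.det * hsq

lemma exists_two_pow_add {n : ℕ} (hn : 0 < n) : ∃ k t, n = 2 ^ k + t ∧ t < 2 ^ k := by
  refine ⟨Nat.log 2 n, n - 2 ^ Nat.log 2 n, ?_, ?_⟩
  · have := Nat.pow_log_le_self 2 hn.ne'
    omega
  · have := Nat.lt_pow_succ_log_self (b := 2) (by norm_num) n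
    rw [pow_succ] at this
    omega

lemma sign_hankel_negPowTwoSeq (n : ℕ) {x y : ℤ} (hx : 0 < x) (hy : 0 < y) :
    (hankel (negPowTwoSeq x) (n + 1)).sign = (hankel (negPowTwoSeq y) (n + 1)).sign ∧
      hankel (negPowTwoSeq x) (n + 1) ≠ 0 := by
  induction n using Nat.strong_induction_on generalizing x y with
  | _ n ih =>
    rcases Nat.eq_zero_or_pos n with rfl | hn
    · simp [hankel, negPowTwoSeq, Int.sign_eq_one_of_pos, hx, hy, hx.ne']
    · obtain ⟨k, t, rfl, ht⟩ := exists_two_pow_add hn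
      obtain ⟨q, hq⟩ := Nat.exists_eq_add_of_lt ht
      have e : 2 ^ k + t + 1 = (q + 1) + (2 * t + 1) := by omega
      rw [e, hankel_negPowTwoSeq x (k := k) (by omega) (by omega),
        hankel_negPowTwoSeq y (k := k) (by omega) (by omega)]
      obtain ⟨h1, h2⟩ := ih q (by omega) (x := x + 1) (y := y + 1) (by omega) (by omega)
      exact ⟨by rw [Int.sign_mul, h1, ← Int.sign_mul], mul_ne_zero (by simp) h2⟩

lemma h_succ_ne_zero (n : ℕ) : h (n + 1) ≠ 0 := by
  rw [h, bseq_eq_negPowTwoSeq]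
  exact (sign_hankel_negPowTwoSeq n one_pos one_pos).2

lemma sign_h_add {q t k : ℕ} (hqt : q + 1 + t = 2 ^ k) :
    (h (2 ^ k + t + 1)).sign = (-1) ^ (t + 1) * (h (q + 1)).sign := by
  have e : 2 ^ k + t + 1 = (q + 1) + (2 * t + 1) := by omega
  rw [h, h, bseq_eq_negPowTwoSeq, e, hankel_negPowTwoSeq 1 (by omega) hqt, Int.sign_mul,
    (sign_hankel_negPowTwoSeq q (x := 1 + 1) (y := 1) (by norm_num) one_pos).1]
  congr 1
  rcases neg_one_pow_eq_or ℤ (t + 1) with h1 | h1 <;> simp [h1]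

lemma u_succ (n : ℕ) : 2 * u (n + 1) = 1 - (h (n + 2)).sign * (h (n + 1)).sign := by
  have h1 := h_succ_ne_zero n
  have h2 := h_succ_ne_zero (n + 1)
  rw [u, isign, isign, show n + 1 + 1 = n + 2 by rfl] at *
  rcases h1.lt_or_gt with h1 | h1 <;> rcases h2.lt_or_gt with h2 | h2 <;>
    simp [Int.sign_eq_one_of_pos, Int.sign_eq_neg_one_of_neg, h1, h2, h1.le, h2.le,
      not_le.2]

lemma sign_h_mul_self (n : ℕ) : (h (n + 1)).sign * (h (n + 1)).sign = 1 := by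
  rcases (h_succ_ne_zero n).lt_or_gt with h1 | h1
  · simp [Int.sign_eq_neg_one_of_neg h1]
  · simp [Int.sign_eq_one_of_pos h1]

lemma u_two_pow (k : ℕ) : u (2 ^ k) = 1 := by
  obtain ⟨q, hq⟩ := Nat.exists_eq_add_of_lt (Nat.two_pow_pos k)
  have h1 := sign_h_add (q := q) (t := 0) (k := k) (by omega)
  have h2 := u_succ q
  have h3 := sign_h_mul_self q
  rw [show 2 ^ k = q + 1 by omega] at *
  simp only [add_zero, zero_add, pow_one, show q + 1 + 1 = q + 2 by rfl] at h1
  rw [h1] at h2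
  linarith

lemma u_two_pow_add {k s t : ℕ} (ht : 0 < t) (hs : 0 < s) (hst : s + t = 2 ^ k) :
    u (2 ^ k + t) = 1 - u s := by
  obtain ⟨t, rfl⟩ := Nat.exists_eq_add_of_lt ht
  obtain ⟨q, rfl⟩ := Nat.exists_eq_add_of_lt hs
  simp only [zero_add] at *
  have h1 := sign_h_add (q := q) (t := t + 1) (k := k) (by omega)
  have h2 := sign_h_add (q := q + 1) (t := t) (k := k) (by omega)
  have h3 := u_succ q
  have h4 := u_succ (2 ^ k + t)
  have hsq : ((-1 : ℤ) ^ t) * (-1) ^ t = 1 := by rw [← mul_pow]; simp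
  rw [show 2 ^ k + (t + 1) + 1 = 2 ^ k + t + 2 by ring] at h1
  rw [h1, h2, show q + 1 + 1 = q + 2 by rfl] at h4
  rw [← add_assoc]
  have h5 : 2 * u (2 ^ k + t + 1) = 2 * (1 - u (q + 1)) := by
    rw [h4, mul_sub, h3]
    linear_combination (h (q + 1)).sign * (h (q + 2)).sign * hsq
  linarith

lemma u_two_mul {n : ℕ} (hn : 1 ≤ n) : u (2 * n) = u n := by
  induction n using Nat.strong_induction_on with
  | _ n ih =>
    obtain ⟨k, t, rfl, ht⟩ := exists_two_pow_add hn
    have e : 2 ^ (k + 1) = 2 * 2 ^ k := by ring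
    rcases Nat.eq_zero_or_pos t with rfl | ht0
    · rw [add_zero, ← e, u_two_pow, u_two_pow]
    · rw [mul_add, ← e, u_two_pow_add (s := 2 * (2 ^ k - t)) (by omega) (by omega) (by omega),
        u_two_pow_add (k := k) (s := 2 ^ k - t) ht0 (by omega) (by omega),
        ih (2 ^ k - t) (by omega) (by omega)]

lemma u_odd (n : ℕ) : (n % 4 = 1 → u n = 1) ∧ (n % 4 = 3 → u n = 0) := by
  induction n using Nat.strong_induction_on with
  | _ n ih =>
    rcases Nat.eq_zero_or_pos n with rfl | hn
    · simp
    obtain ⟨k, t, rfl, ht⟩ := exists_two_pow_add hn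
    match k with
    | 0 =>
      obtain rfl : t = 0 := by simpa using ht
      simpa using u_two_pow 0
    | 1 =>
      refine ⟨by omega, fun h3 => ?_⟩
      obtain rfl : t = 1 := by omega
      rw [u_two_pow_add (s := 1) (by omega) (by omega) (by omega), sub_eq_zero]
      exact (u_two_pow 0).symm
    | k + 2 =>
      have e : 2 ^ (k + 2) = 4 * 2 ^ k := by ring
      rcases Nat.eq_zero_or_pos t with rfl | ht0
      · omega
      obtain ⟨h1, h3⟩ := ih (2 ^ (k + 2) - t) (by omega)
      refine ⟨fun hmod => ?_, fun hmod => ?_⟩ <;>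
        rw [u_two_pow_add (s := 2 ^ (k + 2) - t) (by omega) (by omega) (by omega)]
      · rw [h3 (by omega), sub_zero]
      · rw [h1 (by omega), sub_self]

theorem stmt13 :
    (∀ n : ℕ, 1 ≤ n → u (2 * n) = u n) ∧
    (∀ n : ℕ, u (4 * n + 1) = 1) ∧
    (∀ n : ℕ, u (4 * n + 3) = 0) := by
  exact ⟨fun _ hn => u_two_mul hn, fun n => (u_odd _).1 (by omega), fun n => (u_odd _).2 (by omega)⟩
end

section
/- Let h_n be the n-th Hankel determinant of the coefficient sequence of B(x) = 1 - x·r(x), and for an integer y define y⁺ = y + 1 if y > 0 and y⁺ = y - 1 if y ≤ 0. Then h_0 = h_1 = 1, h_2 = -2, and for all n ≥ 0: h_{8n} = h_{4n}, h_{8n+1} = h_{4n+1}, h_{8n+2} = h_{4n+2}, h_{8n+3} = -(h_{4n+2})⁺, h_{8n+4} = -h_{4n+2}, h_{8n+5} = -h_{4n+3}, h_{8n+6} = (h_{4n+3})⁺, and h_{8n+7} = h_{4n+3}. -/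
/-- `y⁺ = y + 1` if `y > 0`, and `y - 1` if `y ≤ 0`. -/
def plusOp (y : ℤ) : ℤ := if 0 < y then y + 1 else y - 1

/-- Sorting rows and columns by parity turns a Hankel matrix into a block matrix whose blocks are
the Hankel matrices of the even and odd parts of the sequence. -/
theorem hankel_eq_det_fromBlocks (a : ℕ → ℤ) (p q : ℕ) (hqp : q ≤ p) (hpq : p ≤ q + 1) :
    hankel a (p + q) = (Matrix.fromBlocks
      (Matrix.of fun i j : Fin p => a (2 * (i.1 + j.1)))
      (Matrix.of fun (i : Fin p) (j : Fin q) => a (2 * (i.1 + j.1) + 1))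
      (Matrix.of fun (i : Fin q) (j : Fin p) => a (2 * (i.1 + j.1) + 1))
      (Matrix.of fun i j : Fin q => a (2 * (i.1 + j.1) + 2))).det := by
  let f : Fin p ⊕ Fin q → Fin (p + q) := Sum.elim
    (fun i => ⟨2 * i.1, by have := i.2; omega⟩) (fun i => ⟨2 * i.1 + 1, by have := i.2; omega⟩)
  have hf : Function.Bijective f := by
    rw [Fintype.bijective_iff_injective_and_card]
    refine ⟨?_, by simp⟩
    rintro (i | i) (j | j) hij <;> simp only [f, Sum.elim_inl, Sum.elim_inr, Fin.mk.injEq] at hij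
    · exact congrArg _ (Fin.ext (by omega))
    · omega
    · omega
    · exact congrArg _ (Fin.ext (by omega))
  rw [hankel, ← Matrix.det_submatrix_equiv_self (Equiv.ofBijective f hf)]
  congr 1
  ext (i | i) (j | j) <;>
    simp only [f, Matrix.submatrix_apply, Equiv.ofBijective_apply, Matrix.of_apply, Sum.elim_inl,
      Sum.elim_inr, Matrix.fromBlocks_apply₁₁, Matrix.fromBlocks_apply₁₂,
      Matrix.fromBlocks_apply₂₁, Matrix.fromBlocks_apply₂₂] <;>
    congr 1 <;> ring

theorem hankel_of_odd_eq_zero {a : ℕ → ℤ} (ha : ∀ k, a (2 * k + 1) = 0) (p q : ℕ)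
    (hqp : q ≤ p) (hpq : p ≤ q + 1) :
    hankel a (p + q) = hankel (fun k => a (2 * k)) p * hankel (fun k => a (2 * k + 2)) q := by
  rw [hankel_eq_det_fromBlocks a p q hqp hpq]
  simp only [ha]
  exact Matrix.det_fromBlocks_zero₂₁ _ _ _

theorem Matrix.det_fromBlocks_zero_one_one_zero (m : ℕ) :
    (Matrix.fromBlocks 0 1 1 0 : Matrix (Fin m ⊕ Fin m) (Fin m ⊕ Fin m) ℤ).det = (-1) ^ m := by
  have key : (Matrix.fromBlocks 1 1 0 1 : Matrix (Fin m ⊕ Fin m) (Fin m ⊕ Fin m) ℤ) *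
      (Matrix.fromBlocks 0 1 1 0 : Matrix (Fin m ⊕ Fin m) (Fin m ⊕ Fin m) ℤ) =
      Matrix.fromBlocks 1 1 1 0 := by
    simp [Matrix.fromBlocks_multiply]
  have := congrArg Matrix.det key
  rw [Matrix.det_mul, Matrix.det_fromBlocks_zero₂₁, Matrix.det_fromBlocks_one₁₁] at this
  simpa [Matrix.det_neg] using this

theorem hankel_add_self_of_even_eq_zero {a : ℕ → ℤ} (ha : ∀ k, a (2 * k + 2) = 0) (m : ℕ) :
    hankel a (m + m) = (-1) ^ m * hankel (fun k => a (2 * k + 1)) m ^ 2 := by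
  rw [hankel_eq_det_fromBlocks a m m le_rfl (by omega)]
  simp only [ha]
  set A := Matrix.of fun i j : Fin m => a (2 * (i.1 + j.1))
  set B := Matrix.of fun i j : Fin m => a (2 * (i.1 + j.1) + 1)
  have key : Matrix.fromBlocks A B B 0 = Matrix.fromBlocks B A 0 B * Matrix.fromBlocks 0 1 1 0 := by
    simp [Matrix.fromBlocks_multiply]
  change (Matrix.fromBlocks A B B 0).det = _
  rw [key, Matrix.det_mul, Matrix.det_fromBlocks_zero₂₁, Matrix.det_fromBlocks_zero_one_one_zero,
    hankel]
  ring

theorem hankel_eq_zero_of_odd {a : ℕ → ℤ} (ha : ∀ k, a (2 * k) = 0) (m : ℕ) :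
    hankel a (2 * m + 1) = 0 := by
  set M := Matrix.of fun i j : Fin (2 * m + 1) => a (i.1 + j.1) with hM
  let v : Fin (2 * m + 1) → ℤ := fun i => (-1) ^ i.1
  have key : M = -(Matrix.of fun i j => v i * (Matrix.of fun i j => v j * M i j) i j) := by
    ext i j
    simp only [hM, v, Matrix.of_apply, Matrix.neg_apply]
    rcases Nat.even_or_odd' (i.1 + j.1) with ⟨k, hk | hk⟩
    · simp [hk, ha]
    · rw [← mul_assoc, ← pow_add, hk, pow_succ, pow_mul]
      simp
  have hv : (∏ i, v i) * (∏ i, v i) = 1 := by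
    rw [← Finset.prod_mul_distrib]
    exact Finset.prod_eq_one fun i _ => by simp [v, ← mul_pow]
  have hdet := congrArg Matrix.det key
  rw [Matrix.det_neg, Matrix.det_mul_column, Matrix.det_mul_row, ← mul_assoc (∏ i, v i), hv,
    Fintype.card_fin, pow_succ, pow_mul] at hdet
  norm_num at hdet
  change M.det = 0
  omega

/-- Changing the term of index `0` changes a Hankel determinant by a multiple of a minor. -/
theorem hankel_succ_of_eq_of_pos {a b : ℕ → ℤ} (hab : ∀ k, a (k + 1) = b (k + 1)) (n : ℕ) :
    hankel a (n + 1) = hankel b (n + 1) + (a 0 - b 0) * hankel (fun k => a (k + 2)) n := by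
  have hab' : ∀ k, 0 < k → a k = b k := by
    rintro (_ | k) hk
    · omega
    · exact hab k
  have hminor : ∀ j : Fin (n + 1),
      ((Matrix.of fun i j : Fin (n + 1) => a (i.1 + j.1)).submatrix Fin.succ j.succAbove) =
      ((Matrix.of fun i j : Fin (n + 1) => b (i.1 + j.1)).submatrix Fin.succ j.succAbove) := by
    intro j
    ext i k
    exact hab' _ (by simp)
  have hshift : hankel (fun k => a (k + 2)) n =
      ((Matrix.of fun i j : Fin (n + 1) => a (i.1 + j.1)).submatrix Fin.succ
        (0 : Fin (n + 1)).succAbove).det := by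
    rw [hankel]
    congr 1
    ext i j
    simp only [Matrix.of_apply, Matrix.submatrix_apply, Fin.succAbove_zero, Fin.val_succ]
    congr 1
    ring
  rw [hshift, hankel, hankel, Matrix.det_succ_row_zero, Matrix.det_succ_row_zero,
    Fin.sum_univ_succ, Fin.sum_univ_succ]
  simp only [hminor, Matrix.of_apply, Fin.val_zero, Fin.val_succ, zero_add, hab]
  ring

theorem ruep_zero : ruep 0 = 1 := if_pos ⟨0, rfl⟩

theorem ruep_odd (k : ℕ) : ruep (2 * k + 1) = ruep k := by
  unfold ruep
  congr 1
  refine propext ⟨?_, ?_⟩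
  · rintro ⟨_ | m, hm⟩
    · simp at hm
    · refine ⟨m, ?_⟩
      rw [pow_succ] at hm
      omega
  · rintro ⟨m, hm⟩
    refine ⟨m + 1, ?_⟩
    have := Nat.two_pow_pos m
    rw [pow_succ]
    omega

theorem ruep_even (k : ℕ) : ruep (2 * k + 2) = 0 := by
  refine if_neg ?_
  rintro ⟨_ | m, hm⟩
  · simp at hm
  · rw [pow_succ] at hm
    omega

theorem bseq_two_mul (k : ℕ) : bseq (2 * k) = bseq k := by
  cases k with
  | zero => rfl
  | succ k => exact congrArg Neg.neg (ruep_odd k)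

theorem bseq_two_mul_add_three (k : ℕ) : bseq (2 * k + 3) = 0 := by
  simp [bseq, ruep_even]

/-- Hankel determinants of the negated Rueppel sequence shifted by `s`. -/
noncomputable def ruepHankel (s n : ℕ) : ℤ := hankel (fun i => -ruep (i + s)) n

theorem hankel_zero (a : ℕ → ℤ) : hankel a 0 = 1 := Matrix.det_fin_zero

theorem hankel_one (a : ℕ → ℤ) : hankel a 1 = a 0 := by simp [hankel]

theorem ruepHankel_one_add (p q : ℕ) (hqp : q ≤ p) (hpq : p ≤ q + 1) :
    ruepHankel 1 (p + q) = ruepHankel 0 p * ruepHankel 1 q := by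
  unfold ruepHankel
  rw [hankel_of_odd_eq_zero (fun k => neg_eq_zero.2 (ruep_even k)) p q hqp hpq]
  simp only [ruep_odd, add_zero]
  congr 2
  ext k
  exact congrArg Neg.neg (ruep_odd (k + 1))

theorem ruepHankel_two_even (m : ℕ) :
    ruepHankel 2 (2 * m) = (-1) ^ m * ruepHankel 1 m ^ 2 := by
  unfold ruepHankel
  rw [two_mul m, hankel_add_self_of_even_eq_zero (fun k => neg_eq_zero.2 (ruep_even (k + 1)))]
  congr 3
  ext k
  exact congrArg Neg.neg (ruep_odd (k + 1))

theorem ruepHankel_two_odd (m : ℕ) : ruepHankel 2 (2 * m + 1) = 0 :=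
  hankel_eq_zero_of_odd (fun k => neg_eq_zero.2 (ruep_even k)) m

theorem ruepHankel_zero_even (m : ℕ) :
    ruepHankel 0 (2 * m) = (-1) ^ m * ruepHankel 0 m ^ 2 := by
  unfold ruepHankel
  rw [two_mul m, hankel_add_self_of_even_eq_zero (fun k => neg_eq_zero.2 (ruep_even k))]
  simp only [add_zero, ruep_odd]

theorem ruepHankel_zero_odd (m : ℕ) : ruepHankel 0 (2 * m + 1) = -ruepHankel 2 (2 * m) := by
  unfold ruepHankel
  rw [hankel_succ_of_eq_of_pos (b := fun k => if k = 0 then 0 else -ruep k) (by simp),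
    hankel_eq_zero_of_odd]
  · simp [ruep_zero]
  · rintro (_ | k)
    · rfl
    · simp [show 2 * (k + 1) = 2 * k + 2 by ring, ruep_even]

theorem ruepHankel_sq (n : ℕ) : ruepHankel 0 n ^ 2 = 1 ∧ ruepHankel 1 n ^ 2 = 1 := by
  induction n using Nat.strong_induction_on with
  | _ n ih =>
    rcases Nat.even_or_odd' n with ⟨m, rfl | rfl⟩
    · rcases Nat.eq_zero_or_pos m with rfl | hm
      · simp [ruepHankel, hankel_zero]
      · obtain ⟨ih0, ih1⟩ := ih m (by omega)
        rw [ruepHankel_zero_even, two_mul m, ruepHankel_one_add m m le_rfl (by omega)]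
        simp [mul_pow, ih0, ih1, ← pow_mul]
    · rcases Nat.eq_zero_or_pos m with rfl | hm
      · simp [ruepHankel, hankel_one, ruep_zero, show ruep 1 = 1 from ruep_odd 0 ▸ ruep_zero]
      · obtain ⟨_, ih1⟩ := ih m (by omega)
        obtain ⟨ih0, _⟩ := ih (m + 1) (by omega)
        rw [ruepHankel_zero_odd, ruepHankel_two_even, show 2 * m + 1 = m + 1 + m by ring,
          ruepHankel_one_add (m + 1) m (by omega) le_rfl]
        simp [mul_pow, ih0, ih1, ← pow_mul]

theorem ruepHankel_zero_two_mul (m : ℕ) : ruepHankel 0 (2 * m) = (-1) ^ m := by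
  rw [ruepHankel_zero_even, (ruepHankel_sq m).1, mul_one]

theorem ruepHankel_two_two_mul (m : ℕ) : ruepHankel 2 (2 * m) = (-1) ^ m := by
  rw [ruepHankel_two_even, (ruepHankel_sq m).2, mul_one]

theorem ruepHankel_zero_two_mul_add_one (m : ℕ) : ruepHankel 0 (2 * m + 1) = -(-1) ^ m := by
  rw [ruepHankel_zero_odd, ruepHankel_two_two_mul]

/-- The recurrence obtained by sorting the rows and columns of the Hankel matrix by parity. -/
theorem h_add (p q : ℕ) (hqp : q ≤ p) (hpq : p ≤ q + 1) :
    h (p + 1 + (q + 1)) =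
      h (p + 1) * ruepHankel 0 (q + 1) - ruepHankel 1 p * ruepHankel 2 q := by
  unfold h
  rw [hankel_eq_det_fromBlocks bseq (p + 1) (q + 1) (by omega) (by omega)]
  set D := Matrix.of fun i j : Fin (q + 1) => bseq (2 * (i.1 + j.1) + 2) with hD
  have hDdet : D.det = ruepHankel 0 (q + 1) := by
    rw [ruepHankel, hankel]
    congr 1
    ext i j
    exact congrArg Neg.neg (ruep_odd (i.1 + j.1))
  have hunit : IsUnit D.det := by
    rw [hDdet]
    exact IsUnit.of_mul_eq_one _ (by rw [← sq]; exact (ruepHankel_sq _).1)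
  have hadj : D.det * D⁻¹ 0 0 = ruepHankel 2 q := by
    rw [Matrix.inv_def, Matrix.smul_apply, smul_eq_mul, ← mul_assoc,
      Ring.mul_inverse_cancel _ hunit, one_mul, Matrix.adjugate_fin_succ_eq_det_submatrix,
      ruepHankel, hankel]
    simp only [Fin.val_zero, add_zero, pow_zero, one_mul]
    congr 1
    ext i j
    simp only [hD, Matrix.of_apply, Matrix.submatrix_apply, Fin.succAbove_zero, Fin.val_succ]
    refine congrArg Neg.neg ((congrArg ruep ?_).trans (ruep_odd _))
    ring
  have hodd : ∀ k, bseq (2 * k + 1) = if k = 0 then -1 else 0 := by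
    rintro (_ | k)
    · simp [bseq, ruep_zero]
    · exact bseq_two_mul_add_three k
  have := Matrix.invertibleOfIsUnitDet D hunit
  rw [Matrix.det_fromBlocks₂₂, Matrix.invOf_eq_nonsing_inv]
  set c : ℕ → ℤ := fun k => if k = 0 then 1 - D⁻¹ 0 0 else bseq k with hc
  have hschur : (Matrix.of fun i j : Fin (p + 1) => bseq (2 * (i.1 + j.1))) -
      (Matrix.of fun (i : Fin (p + 1)) (j : Fin (q + 1)) => bseq (2 * (i.1 + j.1) + 1)) * D⁻¹ *
      (Matrix.of fun (i : Fin (q + 1)) (j : Fin (p + 1)) => bseq (2 * (i.1 + j.1) + 1)) =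
      Matrix.of fun i j : Fin (p + 1) => c (i.1 + j.1) := by
    ext i j
    simp only [Matrix.sub_apply, Matrix.mul_apply, Matrix.of_apply, hodd, bseq_two_mul, hc,
      Fin.sum_univ_succ]
    by_cases hi : i = 0 <;> by_cases hj : j = 0 <;> simp [hi, hj, bseq]
  rw [hschur]
  change D.det * hankel c (p + 1) = _
  rw [hankel_succ_of_eq_of_pos (b := bseq) (a := c) (by simp [hc]), ← hadj, ← hDdet]
  have hshift : hankel (fun k => c (k + 2)) p = ruepHankel 1 p := by
    simp [hc, bseq, ruepHankel]
  rw [hshift]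
  simp only [hc, bseq, if_true]
  ring

theorem h_even (m : ℕ) :
    h (2 * m + 2) = h (m + 1) * ruepHankel 0 (m + 1) - ruepHankel 1 m * ruepHankel 2 m := by
  rw [← h_add m m le_rfl (by omega)]
  congr 1
  ring

theorem h_odd (m : ℕ) :
    h (2 * m + 3) =
      h (m + 2) * ruepHankel 0 (m + 1) - ruepHankel 1 (m + 1) * ruepHankel 2 m := by
  rw [← h_add (m + 1) m (by omega) (by omega)]
  congr 1
  ring

theorem ruepHankel_one_even (m : ℕ) :
    ruepHankel 1 (2 * m) = ruepHankel 0 m * ruepHankel 1 m := by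
  rw [two_mul, ruepHankel_one_add m m le_rfl (by omega)]

theorem ruepHankel_one_odd (m : ℕ) :
    ruepHankel 1 (2 * m + 1) = ruepHankel 0 (m + 1) * ruepHankel 1 m := by
  rw [← ruepHankel_one_add (m + 1) m (by omega) le_rfl]
  congr 1
  ring

theorem ruepHankel_zero_mul_two_nonpos (m : ℕ) :
    ruepHankel 0 (m + 1) * ruepHankel 2 m ≤ 0 := by
  rcases Nat.even_or_odd' m with ⟨k, rfl | rfl⟩
  · rw [ruepHankel_zero_two_mul_add_one, ruepHankel_two_two_mul]
    nlinarith [sq_nonneg ((-1 : ℤ) ^ k)]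
  · rw [ruepHankel_two_odd, mul_zero]

theorem h_zero : h 0 = 1 := hankel_zero _

theorem h_one : h 1 = 1 := hankel_one _

/-- The determinant `h (n + 1)` is nonzero and its sign is `ruepHankel 1 n`. -/
theorem ruepHankel_one_mul_h_pos (n : ℕ) : 0 < ruepHankel 1 n * h (n + 1) := by
  induction n using Nat.strong_induction_on with
  | _ n ih =>
    rcases Nat.even_or_odd' n with ⟨m, rfl | rfl⟩
    · rcases m with _ | m
      · simp [ruepHankel, hankel_zero, h_one]
      · have hpos := ih (m + 1) (by omega)
        have hle := ruepHankel_zero_mul_two_nonpos m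
        have h0 := (ruepHankel_sq (m + 1)).1
        have h1 := (ruepHankel_sq (m + 1)).2
        rw [ruepHankel_one_even, show 2 * (m + 1) + 1 = 2 * m + 3 by ring, h_odd]
        linear_combination hpos + hle +
          (-ruepHankel 1 (m + 1) * h (m + 2)) * h0 +
          (ruepHankel 0 (m + 1) * ruepHankel 2 m) * h1
    · have hpos := ih m (by omega)
      have hle := ruepHankel_zero_mul_two_nonpos m
      have h0 := (ruepHankel_sq (m + 1)).1
      have h1 := (ruepHankel_sq m).2
      rw [ruepHankel_one_odd, show 2 * m + 1 + 1 = 2 * m + 2 by ring, h_even]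
      linear_combination hpos + hle +
        (-ruepHankel 1 m * h (m + 1)) * h0 + (ruepHankel 0 (m + 1) * ruepHankel 2 m) * h1

theorem plusOp_h_succ (n : ℕ) : plusOp (h (n + 1)) = h (n + 1) + ruepHankel 1 n := by
  have hpos := ruepHankel_one_mul_h_pos n
  unfold plusOp
  rcases sq_eq_one_iff.1 (ruepHankel_sq n).2 with hs | hs
  · rw [hs, one_mul] at hpos
    rw [if_pos hpos, hs]
  · rw [hs, neg_one_mul, neg_pos] at hpos
    rw [if_neg hpos.not_gt, hs]
    ring

theorem ruepHankel_zero_four (n : ℕ) :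
    ruepHankel 0 (4 * n) = 1 ∧ ruepHankel 0 (4 * n + 1) = -1 ∧
    ruepHankel 0 (4 * n + 2) = -1 ∧ ruepHankel 0 (4 * n + 3) = 1 := by
  have e0 := ruepHankel_zero_two_mul (2 * n)
  have e1 := ruepHankel_zero_two_mul_add_one (2 * n)
  have e2 := ruepHankel_zero_two_mul (2 * n + 1)
  have e3 := ruepHankel_zero_two_mul_add_one (2 * n + 1)
  simp only [pow_succ, pow_mul, mul_add, ← mul_assoc, add_assoc] at e0 e1 e2 e3
  norm_num at e0 e1 e2 e3
  exact ⟨e0, e1, e2, e3⟩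

theorem ruepHankel_two_four (n : ℕ) :
    ruepHankel 2 (4 * n) = 1 ∧ ruepHankel 2 (4 * n + 1) = 0 ∧
    ruepHankel 2 (4 * n + 2) = -1 ∧ ruepHankel 2 (4 * n + 3) = 0 := by
  have e0 := ruepHankel_two_two_mul (2 * n)
  have e1 := ruepHankel_two_odd (2 * n)
  have e2 := ruepHankel_two_two_mul (2 * n + 1)
  have e3 := ruepHankel_two_odd (2 * n + 1)
  simp only [pow_succ, pow_mul, mul_add, ← mul_assoc, add_assoc] at e0 e1 e2 e3
  norm_num at e0 e1 e2 e3
  exact ⟨e0, e1, e2, e3⟩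

theorem h_four_mul_add_one (n : ℕ) : h (4 * n + 1) = h (2 * n + 1) * (-1) ^ n := by
  rcases n with _ | n
  · simp
  · have := h_odd (2 * n + 1)
    rw [ruepHankel_two_odd, show 2 * n + 1 + 1 = 2 * (n + 1) by ring,
      ruepHankel_zero_two_mul, mul_zero, sub_zero] at this
    exact (congrArg h (by ring)).trans this

theorem h_four_mul_add_two (n : ℕ) :
    h (4 * n + 2) = -h (4 * n + 1) - ruepHankel 1 (4 * n) := by
  have e := h_even (2 * n)
  have e' := ruepHankel_one_even (2 * n)
  rw [ruepHankel_two_two_mul, ruepHankel_zero_two_mul_add_one] at e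
  rw [ruepHankel_zero_two_mul] at e'
  rw [h_four_mul_add_one, show 4 * n = 2 * (2 * n) by ring, e, e']
  ring

theorem h_four_mul_add_three (n : ℕ) :
    h (4 * n + 3) = h (4 * n + 4) + ruepHankel 1 (4 * n + 3) := by
  have e := h_odd (2 * n)
  have e' := h_even (2 * n + 1)
  have e'' := ruepHankel_one_odd (2 * n + 1)
  rw [ruepHankel_two_two_mul, ruepHankel_zero_two_mul_add_one] at e
  rw [ruepHankel_two_odd, show 2 * n + 1 + 1 = 2 * (n + 1) by ring, ruepHankel_zero_two_mul] at e'
  rw [show 2 * n + 1 + 1 = 2 * (n + 1) by ring, ruepHankel_zero_two_mul] at e''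
  rw [show 4 * n + 4 = 2 * (2 * n + 1) + 2 by ring, e', show 4 * n + 3 = 2 * (2 * n) + 3 by ring, e,
    show 2 * (2 * n) + 3 = 2 * (2 * n + 1) + 1 by ring, e'', show 2 * (n + 1) = 2 * n + 2 by ring]
  ring

theorem stmt14 :
    h 0 = 1 ∧ h 1 = 1 ∧ h 2 = -2 ∧
    ∀ n : ℕ,
      h (8 * n) = h (4 * n) ∧
      h (8 * n + 1) = h (4 * n + 1) ∧
      h (8 * n + 2) = h (4 * n + 2) ∧
      h (8 * n + 3) = -(plusOp (h (4 * n + 2))) ∧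
      h (8 * n + 4) = -h (4 * n + 2) ∧
      h (8 * n + 5) = -h (4 * n + 3) ∧
      h (8 * n + 6) = plusOp (h (4 * n + 3)) ∧
      h (8 * n + 7) = h (4 * n + 3) := by
  have h_two : h 2 = -2 := by
    have := h_four_mul_add_two 0
    simpa [h_one, ruepHankel, hankel_zero] using this
  refine ⟨h_zero, h_one, h_two, fun n => ?_⟩
  obtain ⟨r0, r1, r2, r3⟩ := ruepHankel_zero_four n
  obtain ⟨s0, s1, s2, s3⟩ := ruepHankel_two_four n
  refine ⟨?_, ?_, ?_, ?_, ?_, ?_, ?_, ?_⟩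
  · rcases n with _ | n
    · rfl
    · have e := h_even (4 * n + 3)
      rw [(ruepHankel_two_four n).2.2.2, show 4 * n + 3 + 1 = 4 * (n + 1) by ring, r0] at e
      rw [show 8 * (n + 1) = 2 * (4 * n + 3) + 2 by ring, e]
      ring
  · rcases n with _ | n
    · rfl
    · have e := h_odd (4 * n + 3)
      rw [(ruepHankel_two_four n).2.2.2, show 4 * n + 3 + 1 = 4 * (n + 1) by ring, r0] at e
      rw [show 8 * (n + 1) + 1 = 2 * (4 * n + 3) + 3 by ring, e, mul_one, mul_zero, sub_zero]
      exact congrArg h (by ring)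
  · have e := h_even (4 * n)
    rw [show 8 * n + 2 = 2 * (4 * n) + 2 by ring, e, r1, s0, h_four_mul_add_two]
    ring
  · have e := h_odd (4 * n)
    rw [show 8 * n + 3 = 2 * (4 * n) + 3 by ring, e, r1, s0, plusOp_h_succ (4 * n + 1)]
    ring
  · have e := h_even (4 * n + 1)
    rw [show 8 * n + 4 = 2 * (4 * n + 1) + 2 by ring, e, r2, s1]
    ring
  · have e := h_odd (4 * n + 1)
    rw [show 8 * n + 5 = 2 * (4 * n + 1) + 3 by ring, e, r2, s1]
    ring
  · have e := h_even (4 * n + 2)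
    rw [show 8 * n + 6 = 2 * (4 * n + 2) + 2 by ring, e, r3, s2, plusOp_h_succ (4 * n + 2)]
    ring
  · have e := h_odd (4 * n + 2)
    rw [show 8 * n + 7 = 2 * (4 * n + 2) + 3 by ring, e, r3, s2, h_four_mul_add_three]
    ring
end

section
/- Let g_n be the n-th Hankel determinant of the sequence (-r_1, -r_2, -r_3, ...). Then for all n ≥ 0: g_{4n+1} = g_{2n+1}, g_{4n+2} = g_{2n}, g_{4n+3} = g_{2n}, g_{8n} = g_{4n}, g_{16n+4} = g_{2n+1}, and g_{16n+12} = g_{8n+4}. (In particular the 2-kernel of (g_n) is finite, i.e., (g_n) is 2-automatic.) -/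
theorem ruep_two_mul_add_one (n : ℕ) : ruep (2 * n + 1) = ruep n := by
  unfold ruep
  congr 1
  refine propext ⟨?_, ?_⟩
  · rintro ⟨_ | m, hm⟩
    · simp at hm
    · exact ⟨m, by rw [pow_succ] at hm; omega⟩
  · rintro ⟨m, hm⟩
    have := Nat.one_le_two_pow (n := m)
    exact ⟨m + 1, by rw [pow_succ]; omega⟩

theorem ruep_two_mul_add_two (n : ℕ) : ruep (2 * n + 2) = 0 := by
  refine if_neg ?_
  rintro ⟨_ | m, hm⟩
  · simp at hm
  · rw [pow_succ] at hm
    omega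

theorem hankel_neg (a : ℕ → ℤ) (n : ℕ) : hankel (fun i => -a i) n = (-1) ^ n * hankel a n := by
  unfold hankel
  rw [show (Matrix.of fun i j : Fin n => -a (i.1 + j.1)) =
    -(Matrix.of fun i j : Fin n => a (i.1 + j.1)) from rfl, Matrix.det_neg, Fintype.card_fin]

/-- A Hankel determinant may be computed along any enumeration of its index set. -/
theorem hankel_eq_det {ι : Type*} [Fintype ι] [DecidableEq ι] (a : ℕ → ℤ) {n : ℕ} (f : ι → ℕ)
    (hf : ∀ i, f i < n) (hinj : Function.Injective f) (hcard : Fintype.card ι = n) :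
    hankel a n = Matrix.det (Matrix.of fun i j => a (f i + f j)) := by
  let e : ι ≃ Fin n := Equiv.ofBijective (fun i => ⟨f i, hf i⟩)
    ((Fintype.bijective_iff_injective_and_card _).2
      ⟨fun i j hij => hinj (by simpa using hij), by simpa using hcard⟩)
  exact (Matrix.det_submatrix_equiv_self e _).symm

theorem det_fromBlocks_zero_diag {n : Type*} [Fintype n] [DecidableEq n] (B X : Matrix n n ℤ) :
    (Matrix.fromBlocks 0 B B X).det = (-1) ^ Fintype.card n * B.det ^ 2 := by
  have hswap : (Matrix.fromBlocks 0 1 1 0 : Matrix (n ⊕ n) (n ⊕ n) ℤ).det =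
      (-1) ^ Fintype.card n := by
    have hmul : (Matrix.fromBlocks 1 1 0 1 : Matrix (n ⊕ n) (n ⊕ n) ℤ) *
        Matrix.fromBlocks 0 1 1 0 = Matrix.fromBlocks 1 1 1 0 := by
      simp [Matrix.fromBlocks_multiply]
    have hdet := congrArg Matrix.det hmul
    rw [Matrix.det_mul, Matrix.det_fromBlocks_zero₂₁, Matrix.det_fromBlocks_one₁₁] at hdet
    simpa [Matrix.det_neg] using hdet
  have hmul : Matrix.fromBlocks 0 B B X =
      Matrix.fromBlocks 0 1 1 0 * Matrix.fromBlocks B X 0 B := by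
    simp [Matrix.fromBlocks_multiply]
  rw [hmul, Matrix.det_mul, hswap, Matrix.det_fromBlocks_zero₂₁, sq]

theorem hankel_ruep_two_mul (k : ℕ) : hankel ruep (2 * k) = (-1) ^ k * hankel ruep k ^ 2 := by
  rw [hankel_eq_det (ι := Fin k ⊕ Fin k) ruep (Sum.elim (fun i => 2 * i.1 + 1) (fun i => 2 * i.1))
    (by rintro (i | i) <;> simp only [Sum.elim_inl, Sum.elim_inr] <;> omega)
    (by rintro (i | i) (j | j) hij <;> simp [Fin.ext_iff] at hij ⊢ <;> omega)
    (by simp; ring)]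
  have hblocks := det_fromBlocks_zero_diag (Matrix.of fun i j : Fin k => ruep (i.1 + j.1))
    (Matrix.of fun i j : Fin k => ruep (2 * i.1 + 2 * j.1))
  rw [Fintype.card_fin] at hblocks
  rw [hankel, ← hblocks]
  congr 1
  ext (i | i) (j | j) <;> simp
  · rw [← ruep_two_mul_add_two (i + j)]; congr 1; ring
  · rw [← ruep_two_mul_add_one (i + j)]; congr 1; ring
  · rw [← ruep_two_mul_add_one (i + j)]; congr 1; ring

theorem hankel_ruep_two_mul_add_one (k : ℕ) :
    hankel ruep (2 * k + 1) = (-1) ^ k * hankel (fun i => ruep (i + 1)) k ^ 2 := by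
  rw [hankel_eq_det (ι := Unit ⊕ (Fin k ⊕ Fin k)) ruep
    (Sum.elim (fun _ => 0) (Sum.elim (fun i => 2 * i.1 + 2) (fun i => 2 * i.1 + 1)))
    (by rintro (i | i | i) <;> simp only [Sum.elim_inl, Sum.elim_inr] <;> omega)
    (by rintro (i | i | i) (j | j | j) hij <;> simp [Fin.ext_iff] at hij ⊢ <;> omega)
    (by simp; ring)]
  have hblocks := det_fromBlocks_zero_diag (Matrix.of fun i j : Fin k => ruep (i.1 + j.1 + 1))
    (Matrix.of fun i j : Fin k => -(ruep i * ruep j))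
  rw [Fintype.card_fin] at hblocks
  let v : Fin k ⊕ Fin k → ℤ := Sum.elim (fun _ => 0) (fun i => ruep i)
  have hmat : (Matrix.of fun i j : Unit ⊕ (Fin k ⊕ Fin k) => ruep
      (Sum.elim (fun _ => 0) (Sum.elim (fun i => 2 * i.1 + 2) (fun i => 2 * i.1 + 1)) i +
        Sum.elim (fun _ => 0) (Sum.elim (fun i => 2 * i.1 + 2) (fun i => 2 * i.1 + 1)) j)) =
      Matrix.fromBlocks 1 (Matrix.of fun _ j => v j) (Matrix.of fun i _ => v i)
        (Matrix.fromBlocks 0 (Matrix.of fun i j : Fin k => ruep (i.1 + j.1 + 1))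
          (Matrix.of fun i j : Fin k => ruep (i.1 + j.1 + 1)) 0) := by
    ext (i | i | i) (j | j | j) <;>
      simp [v, ruep_zero, ruep_two_mul_add_one, ruep_two_mul_add_two]
    · rw [← ruep_two_mul_add_two (i + j + 1)]; congr 1; ring
    · rw [← ruep_two_mul_add_one (i + j + 1)]; congr 1; ring
    · rw [← ruep_two_mul_add_one (i + j + 1)]; congr 1; ring
    · rw [← ruep_two_mul_add_two (i + j)]; congr 1; ring
  rw [hmat, Matrix.det_fromBlocks_one₁₁, hankel, ← hblocks]
  congr 1
  ext (i | i) (j | j) <;> simp [v, Matrix.mul_apply]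

/-- Splitting the index set by parity makes the matrix of `g` block diagonal. -/
theorem g_eq_mul {n k l : ℕ} (hn : n = k + l) (hkl : l ≤ k) (hlk : k ≤ l + 1) :
    g n = hankel (fun i => -ruep i) k * g l := by
  rw [g, hankel_eq_det (ι := Fin k ⊕ Fin l) _
    (Sum.elim (fun i => 2 * i.1) (fun i => 2 * i.1 + 1))
    (by rintro (i | i) <;> simp only [Sum.elim_inl, Sum.elim_inr] <;> omega)
    (by rintro (i | i) (j | j) hij <;> simp [Fin.ext_iff] at hij ⊢ <;> omega)
    (by simp [hn])]
  rw [g, hankel, hankel, ← Matrix.det_fromBlocks_zero₂₁ _ 0]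
  congr 1
  ext (i | i) (j | j) <;> simp
  · rw [← ruep_two_mul_add_one (i + j)]; congr 1; ring
  · rw [← ruep_two_mul_add_two (i + j)]; congr 1; ring
  · rw [← ruep_two_mul_add_two (i + j)]; congr 1; ring
  · rw [← ruep_two_mul_add_one (i + j + 1)]; congr 1; ring

theorem g_sq_eq (n : ℕ) : g n ^ 2 = hankel (fun i => ruep (i + 1)) n ^ 2 := by
  rw [g, hankel_neg fun i => ruep (i + 1), mul_pow, ← pow_mul, mul_comm n 2, pow_mul]
  simp

theorem hankel_ruep_sq_and_g_sq (n : ℕ) : hankel ruep n ^ 2 = 1 ∧ g n ^ 2 = 1 := by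
  have sign_sq (k : ℕ) : ((-1 : ℤ) ^ k) ^ 2 = 1 := by
    rw [← pow_mul, mul_comm, pow_mul]; simp
  induction n using Nat.strong_induction_on with
  | _ n ih =>
    rcases Nat.eq_zero_or_pos n with rfl | hpos
    · simp [g, hankel_zero]
    have hr : hankel ruep n ^ 2 = 1 := by
      obtain ⟨k, rfl | rfl⟩ := Nat.even_or_odd' n
      · rw [hankel_ruep_two_mul, (ih k (by omega)).1, mul_one, sign_sq]
      · rw [hankel_ruep_two_mul_add_one, ← g_sq_eq, (ih k (by omega)).2, mul_one, sign_sq]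
    refine ⟨hr, ?_⟩
    have hhalf : hankel ruep (n - n / 2) ^ 2 = 1 := by
      rcases Nat.eq_or_lt_of_le (show 1 ≤ n from hpos) with rfl | hlt
      · exact hr
      · exact (ih _ (by omega)).1
    rw [g_eq_mul (k := n - n / 2) (l := n / 2) (by omega) (by omega) (by omega), hankel_neg,
      mul_pow, mul_pow, sign_sq, hhalf, (ih (n / 2) (by omega)).2]
    rfl

theorem hankel_neg_ruep_two_mul (k : ℕ) : hankel (fun i => -ruep i) (2 * k) = (-1) ^ k := by
  rw [hankel_neg, hankel_ruep_two_mul, (hankel_ruep_sq_and_g_sq k).1, pow_mul]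
  simp

theorem hankel_neg_ruep_two_mul_add_one (k : ℕ) :
    hankel (fun i => -ruep i) (2 * k + 1) = (-1) ^ (k + 1) := by
  rw [hankel_neg, hankel_ruep_two_mul_add_one, ← g_sq_eq, (hankel_ruep_sq_and_g_sq k).2,
    pow_succ, pow_mul]
  simp [pow_succ]

theorem g_four_mul (k : ℕ) : g (4 * k) = (-1) ^ k * g (2 * k) := by
  rw [g_eq_mul (k := 2 * k) (l := 2 * k) (by omega) (by omega) (by omega),
    hankel_neg_ruep_two_mul]

theorem g_four_mul_add_one (k : ℕ) : g (4 * k + 1) = (-1) ^ (k + 1) * g (2 * k) := by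
  rw [g_eq_mul (k := 2 * k + 1) (l := 2 * k) (by omega) (by omega) (by omega),
    hankel_neg_ruep_two_mul_add_one]

theorem g_four_mul_add_two (k : ℕ) : g (4 * k + 2) = (-1) ^ (k + 1) * g (2 * k + 1) := by
  rw [g_eq_mul (k := 2 * k + 1) (l := 2 * k + 1) (by omega) (by omega) (by omega),
    hankel_neg_ruep_two_mul_add_one]

theorem g_four_mul_add_three (k : ℕ) : g (4 * k + 3) = (-1) ^ (k + 1) * g (2 * k + 1) := by
  rw [g_eq_mul (k := 2 * (k + 1)) (l := 2 * k + 1) (by omega) (by omega) (by omega),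
    hankel_neg_ruep_two_mul]

theorem g_two_mul_add_one (n : ℕ) : g (2 * n + 1) = (-1) ^ (n + 1) * g (2 * n) := by
  obtain ⟨k, rfl | rfl⟩ := Nat.even_or_odd' n
  · rw [← mul_assoc, show 2 * 2 = 4 from rfl, g_four_mul_add_one, g_four_mul, pow_succ _ (2 * k),
      pow_mul, pow_succ]
    simp
  · rw [show 2 * (2 * k + 1) + 1 = 4 * k + 3 by ring, show 2 * (2 * k + 1) = 4 * k + 2 by ring,
      g_four_mul_add_three, g_four_mul_add_two, show 2 * k + 1 + 1 = 2 * (k + 1) by ring,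
      pow_mul _ 2]
    simp

theorem g_four_mul_add_two_eq (n : ℕ) : g (4 * n + 2) = g (2 * n) := by
  rw [g_four_mul_add_two, g_two_mul_add_one, ← mul_assoc, ← mul_pow]
  simp

theorem stmt16 :
    ∀ n : ℕ,
      g (4 * n + 1) = g (2 * n + 1) ∧
      g (4 * n + 2) = g (2 * n) ∧
      g (4 * n + 3) = g (2 * n) ∧
      g (8 * n) = g (4 * n) ∧
      g (16 * n + 4) = g (2 * n + 1) ∧
      g (16 * n + 12) = g (8 * n + 4) := by
  intro n
  refine ⟨?_, g_four_mul_add_two_eq n, ?_, ?_, ?_, ?_⟩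
  · rw [g_four_mul_add_one, g_two_mul_add_one]
  · rw [g_four_mul_add_three, ← g_four_mul_add_two, g_four_mul_add_two_eq]
  · rw [show 8 * n = 4 * (2 * n) by ring, g_four_mul, pow_mul, ← mul_assoc]
    simp
  · rw [show 16 * n + 4 = 4 * (4 * n + 1) by ring, g_four_mul,
      show 2 * (4 * n + 1) = 4 * (2 * n) + 2 by ring, g_four_mul_add_two_eq,
      show 2 * (2 * n) = 4 * n by ring, g_four_mul, g_two_mul_add_one, pow_succ,
      show 4 * n = 2 * (2 * n) by ring, pow_mul _ 2]
    simp [pow_succ]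
  · rw [show 16 * n + 12 = 4 * (4 * n + 3) by ring, g_four_mul,
      show 2 * (4 * n + 3) = 4 * (2 * n + 1) + 2 by ring, g_four_mul_add_two_eq,
      show 8 * n + 4 = 4 * (2 * n + 1) by ring, g_four_mul, pow_succ _ (2 * n), pow_mul,
      show 4 * n + 3 = 2 * (2 * n + 1) + 1 by ring, pow_succ _ (2 * (2 * n + 1)), pow_mul _ 2]
    simp
end
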